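/- Let X ⊂ P^r be an integral nondegenerate projective variety of type I (general entry locus irreducible) such that all secant varieties of the general entry locus Γ_q(X) have the expected dimension. Then X is of type A if and only if ℓ(X) = (γ(X)+1)·r_gen(X) − γ(X) − 1, where γ(X) = dim Γ_q(X) and ℓ(X) = dim⟨Γ_q(X)⟩. -/

import Mathlib

open MvPolynomial

noncomputable section

namespace EL

variable {k : Type} [Field k] {n : ℕ}

/-- Projective space of (vector) dimension `n` over `k`. -/
abbrev PS (k : Type) [Field k] (n : ℕ) : Type := Projectivization k (Fin n → k)

/-- Projective vanishing set of a polynomial (intended to be homogeneous). -/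
def V0 (f : MvPolynomial (Fin n) k) : Set (PS k n) :=
  {p | ∀ (v : Fin n → k) (hv : v ≠ 0), Projectivization.mk k v hv = p → eval v f = 0}

/-- The Zariski topology on projective space, generated by complements of vanishing
sets of homogeneous polynomials. -/
instance : TopologicalSpace (PS k n) :=
  TopologicalSpace.generateFrom
    {U | ∃ (d : ℕ) (f : MvPolynomial (Fin n) k), f.IsHomogeneous d ∧ U = (V0 f)ᶜ}

/-- The linear span (as a submodule of the cone) of a set of projective points. -/
def pspan (S : Set (PS k n)) : Submodule k (Fin n → k) := ⨆ p ∈ S, p.submodule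

/-- The projective linear subspace associated to a submodule. -/
def linSet (W : Submodule k (Fin n → k)) : Set (PS k n) := {p | p.submodule ≤ W}

/-- `q` lies in the projective span of `S`. -/
def memSpan (q : PS k n) (S : Set (PS k n)) : Prop := q.submodule ≤ pspan S

/-- The projective dimension of the span of `S`. -/
def spanDim (S : Set (PS k n)) : ℕ := Module.finrank k ↥(pspan S) - 1

/-- `S` is nondegenerate (spans the ambient projective space). -/
def Nondeg (S : Set (PS k n)) : Prop := pspan S = ⊤

/-- `S` is a projective linear subspace of projective dimension `d`. -/
def IsLin (S : Set (PS k n)) (d : ℕ) : Prop :=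
  ∃ W : Submodule k (Fin n → k), Module.finrank k ↥W = d + 1 ∧ S = linSet W

/-- Dimension of a subset, as topological Krull dimension. -/
def pdim (S : Set (PS k n)) : WithBot ℕ∞ := topologicalKrullDim ↥S

/-- An integral (sub)variety: an irreducible Zariski-closed set. -/
def IsVariety (S : Set (PS k n)) : Prop := IsClosed S ∧ IsIrreducible S

/-- A property holds for a general point of projective space. -/
def Generic (P : PS k n → Prop) : Prop :=
  ∃ U : Set (PS k n), IsOpen U ∧ Dense U ∧ ∀ q ∈ U, P q

/-- A property holds for a general point of the set `S`. -/
def GenericIn (S : Set (PS k n)) (P : PS k n → Prop) : Prop :=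
  ∃ U : Set (PS k n), IsOpen U ∧ S ⊆ closure (S ∩ U) ∧ ∀ q ∈ S ∩ U, P q

/-- A property holds for a general tuple of points of projective space. -/
def GenericP {ι : Type} (P : (ι → PS k n) → Prop) : Prop :=
  ∃ U : Set (ι → PS k n), IsOpen U ∧ Dense U ∧ ∀ z ∈ U, P z

/-- `q` is spanned by some `s` points of `X`. -/
def hasDecomp (X : Set (PS k n)) (q : PS k n) (s : ℕ) : Prop :=
  ∃ A : Finset (PS k n), ↑A ⊆ X ∧ A.card = s ∧ memSpan q ↑A

/-- The `X`-rank of a point `q`. -/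
def rk (X : Set (PS k n)) (q : PS k n) : ℕ := sInf {s | hasDecomp X q s}

/-- `A` irredundantly spans `q`. -/
def Irredundant (q : PS k n) (A : Finset (PS k n)) : Prop :=
  memSpan q ↑A ∧ ∀ B : Finset (PS k n), B ⊂ A → ¬ memSpan q ↑B

/-- The set `𝒮(X,q)` of minimal irredundant decompositions of `q` by points of `X`. -/
def decomps (X : Set (PS k n)) (q : PS k n) : Set (Finset (PS k n)) :=
  {A | ↑A ⊆ X ∧ A.card = rk X q ∧ Irredundant q A}

/-- The entry locus of `q` with respect to `X`. -/
def entryLocus (X : Set (PS k n)) (q : PS k n) : Set (PS k n) :=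
  closure (⋃ A ∈ decomps X q, (↑A : Set (PS k n)))

/-- The `s`-th secant variety of `X`. -/
def secant (X : Set (PS k n)) (s : ℕ) : Set (PS k n) :=
  closure {q | hasDecomp X q s}

/-- The generic `X`-rank: least `s` whose secant fills the span of `X`. -/
def rgen (X : Set (PS k n)) : ℕ := sInf {s | secant X s = linSet (pspan X)}

/-- Type I: the general entry locus is irreducible. -/
def TypeI (X : Set (PS k n)) : Prop := Generic (fun q => IsIrreducible (entryLocus X q))

/-- Type II: the general entry locus is reducible. -/
def TypeII (X : Set (PS k n)) : Prop := Generic (fun q => ¬ IsIrreducible (entryLocus X q))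

/-- Type A: the entry locus does not change at a general point of its span. -/
def TypeA (X : Set (PS k n)) : Prop :=
  Generic (fun q => GenericIn (linSet (pspan (entryLocus X q)))
    (fun o => entryLocus X o = entryLocus X q))

/-- `S` (of dimension `m`) has degree `d`: `d` is the largest finite number of points cut
on `S` by a linear subspace of complementary dimension. -/
def HasDegree (S : Set (PS k n)) (m d : ℕ) : Prop :=
  IsGreatest {t | ∃ L : Set (PS k n), IsLin L (n - 1 - m) ∧ (S ∩ L).Finite ∧
    (S ∩ L).ncard = t} d

/-- All secant varieties of `Y` (of dimension `m`) have the expected dimension. -/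
def NonDefective (Y : Set (PS k n)) (m : ℕ) : Prop :=
  ∀ s : ℕ, 1 ≤ s →
    pdim (secant Y s) = ((min ((m+1)*s - 1) (spanDim Y) : ℕ) : WithBot ℕ∞)

/-- `π_o(T) ⊆ π_o(Y)`: every point of `T` (other than `o`) is collinear with `o`
and a point of `Y`. -/
def projLE (o : PS k n) (T Y : Set (PS k n)) : Prop :=
  ∀ t ∈ T, t ≠ o → ∃ y ∈ Y, t.submodule ≤ o.submodule ⊔ y.submodule

/-- A Segre point of the pair `(Y,T)`: projection from `o` maps `Y` and `T`
onto the same set. -/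
def SegrePtPair (Y T : Set (PS k n)) (o : PS k n) : Prop :=
  o ∉ Y ∪ T ∧ projLE o Y T ∧ projLE o T Y

/-- A Segre point of `Y`: the projection from `o` is non-birational on `Y`
(it is not generically injective). -/
def SegrePt (Y : Set (PS k n)) (o : PS k n) : Prop :=
  o ∉ Y ∧ ¬ GenericIn Y (fun y => ∀ y' ∈ Y, y'.submodule ≤ o.submodule ⊔ y.submodule → y' = y)

/-- The Segre locus of `Y`. -/
def segreLocus (Y : Set (PS k n)) : Set (PS k n) := closure {o | SegrePt Y o}

/-- `X` is a cone with vertex `v`. -/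
def IsCone (X : Set (PS k n)) (v : PS k n) : Prop :=
  ∀ p ∈ X, ∀ q : PS k n, q.submodule ≤ v.submodule ⊔ p.submodule → q ∈ X

/-- The homogeneous polynomials vanishing on `X`. -/
def homogCut (X : Set (PS k n)) : Set (MvPolynomial (Fin n) k) :=
  {f | (∃ d, f.IsHomogeneous d) ∧ X ⊆ V0 f}

/-- The span of the gradients at `p` of homogeneous polynomials vanishing on `X`. -/
def gradSpan (X : Set (PS k n)) (p : PS k n) : Submodule k (Fin n → k) :=
  Submodule.span k ((fun f => fun i => eval p.rep (pderiv i f)) '' homogCut X)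

/-- Smoothness at a point of an `m`-dimensional subvariety (Jacobian criterion). -/
def IsSmoothPt (X : Set (PS k n)) (m : ℕ) (p : PS k n) : Prop :=
  Module.finrank k ↥(gradSpan X p) = n - (m + 1)

/-- `X` (of dimension `m`) has only isolated singularities. -/
def IsolatedSings (X : Set (PS k n)) (m : ℕ) : Prop :=
  {p ∈ X | ¬ IsSmoothPt X m p}.Finite

/-- `X` (of dimension `m`) is smooth. -/
def IsSmoothVar (X : Set (PS k n)) (m : ℕ) : Prop := ∀ p ∈ X, IsSmoothPt X m p

/-- The hyperplane (as a submodule) determined by a point of the dual projective space. -/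
def hypSub (a : PS k n) : Submodule k (Fin n → k) :=
  LinearMap.ker (∑ i, a.rep i • (LinearMap.proj i : (Fin n → k) →ₗ[k] k))

/-- The hyperplane determined by a point of the dual projective space. -/
def hypOf (a : PS k n) : Set (PS k n) := linSet (hypSub a)

/-- The (geometric) genus of a space curve `C`, defined by the node count of a
projection from a general point of its span: a general point of `⟨C⟩` lies on
`(d-1)(d-2)/2 - g` secant lines of `C`. -/
def HasGenus (C : Set (PS k n)) (g : ℕ) : Prop :=
  ∃ d : ℕ, HasDegree C 1 d ∧
    GenericIn (linSet (pspan C)) (fun q =>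
      2 * (decomps C q).ncard + 2 * g + 3 * d = d * d + 2)

/-- The embedded tangent space of `X` at `p` (as a submodule of the cone). -/
def tangentSub (X : Set (PS k n)) (p : PS k n) : Submodule k (Fin n → k) :=
  ⨅ f ∈ homogCut X,
    LinearMap.ker (∑ i, (eval p.rep (pderiv i f)) • (LinearMap.proj i : (Fin n → k) →ₗ[k] k))

/-- A curve is tangentially degenerate if its general tangent line meets the
curve elsewhere. -/
def TangDeg (X : Set (PS k n)) : Prop :=
  GenericIn {p ∈ X | IsSmoothPt X 1 p}
    (fun p => ∃ y ∈ X, y ≠ p ∧ y.submodule ≤ tangentSub X p)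

/-- The homogeneous ideal of `X`. -/
def projIdeal (X : Set (PS k n)) : Ideal (MvPolynomial (Fin n) k) :=
  Ideal.span {f | X ⊆ V0 f}

/-- `X` is a normal variety: its homogeneous coordinate ring is integrally closed
in its total fraction ring. -/
def IsNormalVar (X : Set (PS k n)) : Prop :=
  ∀ x : FractionRing (MvPolynomial (Fin n) k ⧸ projIdeal X),
    IsIntegral (MvPolynomial (Fin n) k ⧸ projIdeal X) x →
      ∃ y : MvPolynomial (Fin n) k ⧸ projIdeal X,
        algebraMap (MvPolynomial (Fin n) k ⧸ projIdeal X)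
          (FractionRing (MvPolynomial (Fin n) k ⧸ projIdeal X)) y = x

/-- `C` is an irreducible component of `Y`. -/
def IsCompOf (C Y : Set (PS k n)) : Prop :=
  Maximal (fun Z => Z ⊆ Y ∧ IsIrreducible Z) C

/-- The image of `X` under the linear projection from (the linear space of) `W`,
realized inside the complementary linear space of `Λ`. -/
def projFrom (W Λ : Submodule k (Fin n → k)) (X : Set (PS k n)) : Set (PS k n) :=
  {y | y.submodule ≤ Λ ∧ ∃ x ∈ X, y.submodule ≤ W ⊔ x.submodule}

/-- Decompositions of `q` as irredundant spans of one point from each `Xs i`. -/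
def tupleDecomps {s : ℕ} (Xs : Fin s → Set (PS k n)) (q : PS k n) :
    Set (Fin s → PS k n) :=
  {p | (∀ i, p i ∈ Xs i) ∧ Function.Injective p ∧ memSpan q (Set.range p) ∧
    ∀ i, ¬ memSpan q (Set.range p \ {p i})}

/-- The entry locus of `q` with respect to the tuple of varieties `Xs`. -/
def entryLocusT {s : ℕ} (Xs : Fin s → Set (PS k n)) (q : PS k n) : Set (PS k n) :=
  closure (⋃ p ∈ tupleDecomps Xs q, Set.range p)

/-- The join of the varieties `Xs`. -/
def joinT {s : ℕ} (Xs : Fin s → Set (PS k n)) : Set (PS k n) :=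
  closure {q | ∃ p : Fin s → PS k n, (∀ i, p i ∈ Xs i) ∧ memSpan q (Set.range p)}

/-- Relation `q = F(p)` for a tuple `F` of homogeneous polynomials of the same degree. -/
def polyMapRel {N M : ℕ} (F : Fin M → MvPolynomial (Fin N) k) (p : PS k N) (q : PS k M) :
    Prop :=
  q.submodule = Submodule.span k {fun j => eval p.rep (F j)}

/-- `A` and `B` are isomorphic via mutually inverse polynomial maps. -/
def IsPolyIso {N M : ℕ} (A : Set (PS k N)) (B : Set (PS k M)) : Prop :=
  ∃ (d e : ℕ) (F : Fin M → MvPolynomial (Fin N) k) (G : Fin N → MvPolynomial (Fin M) k),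
    (∀ j, (F j).IsHomogeneous d) ∧ (∀ i, (G i).IsHomogeneous e) ∧
    (∀ p ∈ A, ∃ q ∈ B, polyMapRel F p q ∧ polyMapRel G q p) ∧
    (∀ q ∈ B, ∃ p ∈ A, polyMapRel F p q ∧ polyMapRel G q p)

/-- `A` and `B` are birational: polynomially isomorphic on dense open subsets. -/
def Birational (A B : Set (PS k n)) : Prop :=
  ∃ U V : Set (PS k n), IsOpen U ∧ IsOpen V ∧
    A ⊆ closure (A ∩ U) ∧ B ⊆ closure (B ∩ V) ∧ IsPolyIso (A ∩ U) (B ∩ V)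

/-- A finite set `S` imposes independent conditions on hypersurfaces of degree `i`. -/
def ImposesIndep (S : Finset (PS k n)) (i : ℕ) : Prop :=
  Function.Surjective (fun f : ↥(homogeneousSubmodule (Fin n) k i) =>
    fun p : ↥(↑S : Set (PS k n)) => eval (↑p : PS k n).rep (↑f : MvPolynomial (Fin n) k))

end EL

namespace EL

section Affine

variable {k : Type} [Field k] {σ τ : Type}

/-- A function on affine space given by a polynomial. -/
def IsPolyFun (g : (σ → k) → k) : Prop := ∃ p : MvPolynomial σ k, ∀ a, g a = eval a p

theorem IsPolyFun.eval (f : MvPolynomial σ k) : IsPolyFun fun a => eval a f := ⟨f, fun _ => rfl⟩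

theorem IsPolyFun.const (c : k) : IsPolyFun fun _ : σ → k => c := ⟨C c, fun _ => by simp⟩

theorem IsPolyFun.coord (i : σ) : IsPolyFun fun a : σ → k => a i := ⟨X i, fun _ => by simp⟩

theorem IsPolyFun.add {f g : (σ → k) → k} (hf : IsPolyFun f) (hg : IsPolyFun g) :
    IsPolyFun fun a => f a + g a := by
  obtain ⟨p, hp⟩ := hf
  obtain ⟨q, hq⟩ := hg
  exact ⟨p + q, fun a => by simp [hp, hq]⟩

theorem IsPolyFun.mul {f g : (σ → k) → k} (hf : IsPolyFun f) (hg : IsPolyFun g) :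
    IsPolyFun fun a => f a * g a := by
  obtain ⟨p, hp⟩ := hf
  obtain ⟨q, hq⟩ := hg
  exact ⟨p * q, fun a => by simp [hp, hq]⟩

theorem IsPolyFun.sum {ι : Type} (s : Finset ι) {f : ι → (σ → k) → k}
    (hf : ∀ i, IsPolyFun (f i)) : IsPolyFun fun a => ∑ i ∈ s, f i a := by
  choose p hp using hf
  exact ⟨∑ i ∈ s, p i, fun a => by simp [hp]⟩

theorem eval_aeval_apply (P : τ → MvPolynomial σ k) (a : σ → k) (f : MvPolynomial τ k) :
    MvPolynomial.eval a (aeval P f) = MvPolynomial.eval (fun j => MvPolynomial.eval a (P j)) f := by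
  induction f using MvPolynomial.induction_on with
  | C c => simp
  | add p q hp hq => rw [map_add, map_add, map_add, hp, hq]
  | mul_X p i hp => rw [map_mul, map_mul, map_mul, hp, aeval_X, eval_X]

theorem IsPolyFun.comp {φ : (σ → k) → τ → k} (hφ : ∀ j, IsPolyFun fun a => φ a j)
    {g : (τ → k) → k} (hg : IsPolyFun g) : IsPolyFun fun a => g (φ a) := by
  choose P hP using hφ
  obtain ⟨p, hp⟩ := hg
  refine ⟨aeval P p, fun a => ?_⟩
  have : φ a = fun j => MvPolynomial.eval a (P j) := funext fun j => hP j a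
  change g (φ a) = _
  rw [hp, this, eval_aeval_apply]

theorem IsPolyFun.linear [Fintype σ] (f : (σ → k) →ₗ[k] k) : IsPolyFun f := by
  classical
  have h : (f : (σ → k) → k) = fun a => ∑ i, a i * f (Pi.single i 1) := by
    funext a
    rw [LinearMap.pi_apply_eq_sum_univ f a]
    refine Finset.sum_congr rfl fun i _ => ?_
    rw [smul_eq_mul]
    congr 2
    ext j
    simp [Pi.single_apply, eq_comm]
  rw [h]
  exact .sum _ fun i => (IsPolyFun.coord i).mul (.const _)

/-- Irreducibility of a subset of affine space, in terms of polynomial functions. -/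
structure ZIrr (A : Set (σ → k)) : Prop where
  nonempty : A.Nonempty
  dich : ∀ f g : (σ → k) → k, IsPolyFun f → IsPolyFun g → (∀ a ∈ A, f a * g a = 0) →
    (∀ a ∈ A, f a = 0) ∨ ∀ a ∈ A, g a = 0

theorem ZIrr.image {A : Set (σ → k)} (hA : ZIrr A) {φ : (σ → k) → τ → k}
    (hφ : ∀ j, IsPolyFun fun a => φ a j) : ZIrr (φ '' A) where
  nonempty := hA.nonempty.image _
  dich f g hf hg h := by
    simp only [Set.forall_mem_image] at h ⊢
    exact hA.dich _ _ (.comp hφ hf) (.comp hφ hg) h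

theorem ZIrr.prod {A : Set (σ → k)} {B : Set (τ → k)} (hA : ZIrr A) (hB : ZIrr B) :
    ZIrr {c : σ ⊕ τ → k | c ∘ Sum.inl ∈ A ∧ c ∘ Sum.inr ∈ B} where
  nonempty := by
    obtain ⟨a, ha⟩ := hA.nonempty
    obtain ⟨b, hb⟩ := hB.nonempty
    exact ⟨Sum.elim a b, by simpa using ⟨ha, hb⟩⟩
  dich f g hf hg h := by
    have slice_left : ∀ b : τ → k, ∀ j, IsPolyFun fun a : σ → k => Sum.elim a b j := by
      rintro b (j | j)
      exacts [.coord j, .const _]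
    have slice_right : ∀ a : σ → k, ∀ j, IsPolyFun fun b : τ → k => Sum.elim a b j := by
      rintro a (j | j)
      exacts [.const _, .coord j]
    have key : ∀ a ∈ A, (∀ b ∈ B, f (Sum.elim a b) = 0) ∨ ∀ b ∈ B, g (Sum.elim a b) = 0 :=
      fun a ha => hB.dich _ _ (.comp (slice_right a) hf) (.comp (slice_right a) hg)
        fun b hb => h _ (by simpa using ⟨ha, hb⟩)
    by_contra! hcon
    obtain ⟨⟨c, hc, hfc⟩, d, hd, hgd⟩ := hcon
    rw [← Sum.elim_comp_inl_inr c] at hfc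
    rw [← Sum.elim_comp_inl_inr d] at hgd
    rcases hA.dich (fun a => f (Sum.elim a (c ∘ Sum.inr))) (fun a => g (Sum.elim a (d ∘ Sum.inr)))
      (.comp (slice_left _) hf) (.comp (slice_left _) hg) (fun a ha => by
        rcases key a ha with h1 | h1
        · simp [h1 _ hc.2]
        · simp [h1 _ hd.2]) with h1 | h1
    · exact hfc (h1 _ hc.1)
    · exact hgd (h1 _ hd.1)

theorem ZIrr.univ [Infinite k] : ZIrr (Set.univ : Set (σ → k)) where
  nonempty := ⟨0, trivial⟩
  dich f g hf hg h := by
    obtain ⟨p, hp⟩ := hf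
    obtain ⟨q, hq⟩ := hg
    have : p * q = 0 := MvPolynomial.funext fun a => by simpa [hp, hq] using h a trivial
    rcases mul_eq_zero.1 this with h | h
    · left; intro a _; simp [hp, h]
    · right; intro a _; simp [hq, h]

/-- The tuples of points of `A`, as a subset of affine space. -/
def powSet (A : Set (σ → k)) (t : ℕ) : Set (Fin t × σ → k) := {c | ∀ i, (fun j => c (i, j)) ∈ A}

theorem ZIrr.pow {A : Set (σ → k)} (hA : ZIrr A) (t : ℕ) : ZIrr (powSet A t) := by
  induction t with
  | zero =>
    have : ∀ c d : Fin 0 × σ → k, c = d := fun c d => funext fun x => x.1.elim0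
    refine ⟨⟨0, fun i => i.elim0⟩, fun f g _ _ h => ?_⟩
    rcases mul_eq_zero.1 (h 0 fun i => i.elim0) with h | h
    · left; intro a _; rwa [this a 0]
    · right; intro a _; rwa [this a 0]
  | succ t ih =>
    have := (hA.prod ih).image (φ := fun c (x : Fin (t + 1) × σ) =>
      Fin.cases (motive := fun _ => k) (c (Sum.inl x.2)) (fun i => c (Sum.inr (i, x.2))) x.1) (by
        rintro ⟨i, j⟩
        induction i using Fin.cases with
        | zero => exact .coord _
        | succ i => exact .coord _)
    convert this using 1
    ext c
    constructor
    · intro hc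
      refine ⟨Sum.elim (fun j => c (0, j)) (fun x => c (x.1.succ, x.2)), ⟨hc 0, fun i => hc i.succ⟩,
        ?_⟩
      ext ⟨i, j⟩
      induction i using Fin.cases <;> simp
    · rintro ⟨d, ⟨h0, h1⟩, rfl⟩ i
      induction i using Fin.cases with
      | zero => exact h0
      | succ i => exact h1 i

/-- Chevalley's theorem for closed points: the image of an affine variety under a polynomial map
contains a nonempty open subset of its closure. -/
theorem exists_open_subset_image [IsAlgClosed k] [Finite σ] [Finite τ] {Y : Set (σ → k)}
    (hY : ZIrr Y)
    (hYc : ∀ v, (∀ f : MvPolynomial σ k, (∀ y ∈ Y, eval y f = 0) → eval v f = 0) → v ∈ Y)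
    {φ : (σ → k) → τ → k} (hφ : ∀ j, IsPolyFun fun a => φ a j) :
    ∃ F : MvPolynomial τ k, (∃ y ∈ Y, eval (φ y) F ≠ 0) ∧
      ∀ z, (∀ f : MvPolynomial τ k, (∀ y ∈ Y, eval (φ y) f = 0) → eval z f = 0) →
        eval z F ≠ 0 → ∃ y ∈ Y, φ y = z := by
  classical
  choose P hP using hφ
  have hφP : ∀ a, φ a = fun j => eval a (P j) := fun a => funext fun j => hP j a
  have hev : ∀ a (f : MvPolynomial τ k), eval a (aeval P f) = eval (φ a) f := fun a f => by
    rw [hφP, eval_aeval_apply]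
  let I : Ideal (MvPolynomial σ k) := vanishingIdeal k Y
  have hmem : ∀ f, f ∈ I ↔ ∀ y ∈ Y, eval y f = 0 := fun f => by
    simp [I, mem_vanishingIdeal_iff, MvPolynomial.aeval_eq_eval]
  have hI : I.IsPrime := by
    refine ⟨fun h => ?_, fun {f g} h => ?_⟩
    · obtain ⟨y, hy⟩ := hY.nonempty
      simpa using (hmem 1).1 (h ▸ Submodule.mem_top) y hy
    · rw [hmem] at h
      simpa [hmem] using hY.dich _ _ (.eval f) (.eval g) fun y hy => by simpa using h y hy
  let Φ : MvPolynomial τ k →+* MvPolynomial σ k := (aeval P : _ →ₐ[k] _).toRingHom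
  have hΦft : Φ.FiniteType := by
    refine RingHom.FiniteType.of_comp_finiteType (f := (C : k →+* MvPolynomial τ k)) ?_
    have : Φ.comp C = algebraMap k (MvPolynomial σ k) := by ext x; simp [Φ]
    rw [this, RingHom.finiteType_algebraMap]
    infer_instance
  have hcon : Topology.IsConstructible
      (PrimeSpectrum.comap Φ '' PrimeSpectrum.zeroLocus (I : Set _)) := by
    refine PrimeSpectrum.isConstructible_comap_image
      (RingHom.FinitePresentation.of_finiteType.1 hΦft) ?_
    rw [← Topology.isConstructible_compl]
    exact (PrimeSpectrum.isRetrocompact_zeroLocus_compl_of_fg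
      (IsNoetherian.noetherian I)).isConstructible
      (PrimeSpectrum.isClosed_zeroLocus _).isOpen_compl
  obtain ⟨S, hS⟩ := PrimeSpectrum.exists_constructibleSetData_iff.2 hcon
  have hgen : PrimeSpectrum.comap Φ ⟨I, hI⟩ ∈ S.toSet :=
    hS ▸ ⟨⟨I, hI⟩, (PrimeSpectrum.mem_zeroLocus _ _).2 subset_rfl, rfl⟩
  simp only [PrimeSpectrum.ConstructibleSetData.toSet, Set.mem_iUnion] at hgen
  obtain ⟨D, hDS, hD⟩ := hgen
  simp only [PrimeSpectrum.BasicConstructibleSetData.toSet, Set.mem_sdiff,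
    PrimeSpectrum.mem_zeroLocus, Set.singleton_subset_iff, SetLike.mem_coe,
    PrimeSpectrum.comap_asIdeal, Ideal.mem_comap] at hD
  obtain ⟨hDg, hDf⟩ := hD
  refine ⟨D.f, ?_, fun z hz hzF => ?_⟩
  · by_contra! hcontra
    exact hDf ((hmem _).2 fun y hy => (hev y D.f).trans (hcontra y hy))
  · have hzm : (vanishingIdeal k {z} : Ideal (MvPolynomial τ k)).IsMaximal :=
      isMaximal_iff_eq_vanishingIdeal_singleton |>.2 ⟨z, rfl⟩
    have hzmem : ∀ f, f ∈ (vanishingIdeal k {z} : Ideal (MvPolynomial τ k)) ↔ eval z f = 0 :=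
      fun f => by simp [mem_vanishingIdeal_iff, MvPolynomial.aeval_eq_eval]
    have : (⟨_, hzm.isPrime⟩ : PrimeSpectrum (MvPolynomial τ k)) ∈ S.toSet := by
      simp only [PrimeSpectrum.ConstructibleSetData.toSet, Set.mem_iUnion]
      refine ⟨D, hDS, ?_⟩
      simp only [PrimeSpectrum.BasicConstructibleSetData.toSet, Set.mem_sdiff,
        PrimeSpectrum.mem_zeroLocus, Set.singleton_subset_iff, SetLike.mem_coe]
      refine ⟨fun f hf => (hzmem f).2 (hz f fun y hy => ?_), fun h => hzF ((hzmem _).1 h)⟩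
      have := hDg hf
      simp only [SetLike.mem_coe, Ideal.mem_comap] at this
      rw [← hev]
      exact (hmem _).1 this y hy
    rw [hS] at this
    obtain ⟨Q, hQI, hQ⟩ := this
    obtain ⟨M, hM, hQM⟩ := Q.asIdeal.exists_le_maximal Q.2.ne_top
    obtain ⟨y, rfl⟩ := (isMaximal_iff_eq_vanishingIdeal_singleton).1 hM
    have hymem : ∀ f, f ∈ (vanishingIdeal k {y} : Ideal (MvPolynomial σ k)) ↔ eval y f = 0 :=
      fun f => by simp [mem_vanishingIdeal_iff, MvPolynomial.aeval_eq_eval]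
    refine ⟨y, hYc y fun f hf => (hymem f).1 (hQM (hQI ((hmem f).2 hf))), funext fun j => ?_⟩
    have h1 : (X j - C (z j) : MvPolynomial τ k) ∈ Q.asIdeal.comap Φ := by
      have h2 := congrArg PrimeSpectrum.asIdeal hQ
      rw [PrimeSpectrum.comap_asIdeal] at h2
      rw [h2]
      exact (hzmem _).2 (by simp)
    have h3 := (hymem _).1 (hQM h1)
    have h4 := hev y (X j - C (z j))
    rw [show aeval P (X j - C (z j)) = Φ (X j - C (z j)) from rfl, h3] at h4
    simpa [sub_eq_zero, eq_comm] using h4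

end Affine

section Cone

variable {k : Type} [Field k] {n : ℕ}

/-- The affine cone over a set of projective points. -/
def cone (S : Set (PS k n)) : Set (Fin n → k) := {v | ∀ h : v ≠ 0, Projectivization.mk k v h ∈ S}

theorem mem_cone_mk {S : Set (PS k n)} {v : Fin n → k} (hv : v ≠ 0) :
    v ∈ cone S ↔ Projectivization.mk k v hv ∈ S := ⟨fun h => h hv, fun h _ => h⟩

theorem zero_mem_cone (S : Set (PS k n)) : (0 : Fin n → k) ∈ cone S := fun h => absurd rfl h

theorem cone_mono {S T : Set (PS k n)} (h : S ⊆ T) : cone S ⊆ cone T := fun _ hv h0 => h (hv h0)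

theorem subset_of_cone_subset {S T : Set (PS k n)} (h : cone S ⊆ cone T) : S ⊆ T := by
  intro p hp
  induction p using Projectivization.ind with
  | h v hv => exact h (fun _ => hp) hv

theorem mk_smul {v : Fin n → k} {c : k} (h : c • v ≠ 0) (hv : v ≠ 0) :
    Projectivization.mk k (c • v) h = Projectivization.mk k v hv :=
  (Projectivization.mk_eq_mk_iff' ..).2 ⟨c, rfl⟩

theorem smul_mem_cone {S : Set (PS k n)} {v : Fin n → k} (hv : v ∈ cone S) (c : k) :
    c • v ∈ cone S := by
  intro h
  have h0 : v ≠ 0 := fun h0 => h (by simp [h0])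
  rw [mk_smul h h0]
  exact hv h0

theorem rep_mem_cone {S : Set (PS k n)} {p : PS k n} : p.rep ∈ cone S ↔ p ∈ S := by
  rw [mem_cone_mk p.rep_nonzero, Projectivization.mk_rep]

theorem eval_smul_of_isHomogeneous {f : MvPolynomial (Fin n) k} {d : ℕ} (hf : f.IsHomogeneous d)
    (c : k) (v : Fin n → k) : eval (c • v) f = c ^ d * eval v f := by
  rw [eval_eq, eval_eq, Finset.mul_sum]
  refine Finset.sum_congr rfl fun m hm => ?_
  have hd : ∑ i ∈ m.support, m i = d := by
    have := hf (mem_support_iff.1 hm)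
    simpa [Finsupp.weight_apply, Finsupp.sum] using this
  simp only [Pi.smul_apply, smul_eq_mul, mul_pow, Finset.prod_mul_distrib,
    Finset.prod_pow_eq_pow_sum,
    hd]
  ring

theorem mk_mem_V0 {f : MvPolynomial (Fin n) k} {d : ℕ} (hf : f.IsHomogeneous d) {v : Fin n → k}
    (hv : v ≠ 0) : Projectivization.mk k v hv ∈ V0 f ↔ eval v f = 0 := by
  refine ⟨fun h => h v hv rfl, fun h w hw hwv => ?_⟩
  obtain ⟨c, rfl⟩ := (Projectivization.mk_eq_mk_iff' ..).1 hwv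
  rw [eval_smul_of_isHomogeneous hf, h, mul_zero]

/-- The restriction of a polynomial to the line spanned by `v`. -/
def line (v : Fin n → k) (f : MvPolynomial (Fin n) k) : Polynomial k :=
  aeval (fun i => Polynomial.C (v i) * Polynomial.X) f

theorem eval_line (v : Fin n → k) (f : MvPolynomial (Fin n) k) (c : k) :
    (line v f).eval c = eval (c • v) f := by
  unfold line
  induction f using MvPolynomial.induction_on with
  | C a => simp
  | add p q hp hq => simp [hp, hq]
  | mul_X p i hp =>
    rw [map_mul, aeval_X, Polynomial.eval_mul, hp, map_mul, eval_X, Polynomial.eval_mul,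
      Polynomial.eval_C, Polynomial.eval_X, Pi.smul_apply, smul_eq_mul, mul_comm c]

theorem line_mul (v : Fin n → k) (f g : MvPolynomial (Fin n) k) :
    line v (f * g) = line v f * line v g := map_mul _ _ _

theorem coeff_line [Infinite k] (v : Fin n → k) (f : MvPolynomial (Fin n) k) (d : ℕ) :
    (line v f).coeff d = eval v (homogeneousComponent d f) := by
  have : line v f = ∑ i ∈ Finset.range (f.totalDegree + 1),
      Polynomial.C (eval v (homogeneousComponent i f)) * Polynomial.X ^ i := by
    refine Polynomial.funext fun c => ?_
    rw [eval_line, Polynomial.eval_finsetSum]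
    conv_lhs => rw [← sum_homogeneousComponent f, map_sum]
    refine Finset.sum_congr rfl fun i _ => ?_
    rw [eval_smul_of_isHomogeneous (homogeneousComponent_isHomogeneous i f), Polynomial.eval_mul,
      Polynomial.eval_C, Polynomial.eval_pow, Polynomial.eval_X, mul_comm]
  rw [this, Polynomial.finsetSum_coeff]
  simp only [Polynomial.coeff_C_mul_X_pow]
  rw [Finset.sum_ite_eq]
  split_ifs with h
  · rfl
  · rw [homogeneousComponent_eq_zero _ _ (by simpa using h), map_zero]

theorem eval_homogeneousComponent_eq_zero [Infinite k] {v : Fin n → k}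
    {f : MvPolynomial (Fin n) k} (h : ∀ c : k, c ≠ 0 → eval (c • v) f = 0) (d : ℕ) :
    eval v (homogeneousComponent d f) = 0 := by
  rw [← coeff_line]
  have : line v f = 0 := by
    refine Polynomial.eq_zero_of_infinite_isRoot _ (Set.Infinite.mono (s := {0}ᶜ) ?_ ?_)
    · intro c hc
      exact (eval_line v f c).trans (h c hc)
    · exact (Set.finite_singleton _).infinite_compl
  simp [this]

theorem exists_homogeneousComponent_ne_zero {v : Fin n → k} {f : MvPolynomial (Fin n) k}
    (h : eval v f ≠ 0) : ∃ d, eval v (homogeneousComponent d f) ≠ 0 := by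
  by_contra! hcon
  rw [← sum_homogeneousComponent f, map_sum] at h
  exact h (Finset.sum_eq_zero fun i _ => hcon i)

theorem exists_smul_eval_ne_zero [Infinite k] {v : Fin n → k} {f : MvPolynomial (Fin n) k} {d : ℕ}
    (h : eval v (homogeneousComponent d f) ≠ 0) : ∃ c : k, c ≠ 0 ∧ eval (c • v) f ≠ 0 := by
  by_contra! hcon
  exact h (eval_homogeneousComponent_eq_zero hcon d)

theorem eval_eq_zero_of_mem_cone [Infinite k] {S : Set (PS k n)} (hS : S.Nonempty)
    {f : MvPolynomial (Fin n) k} (h : ∀ v ∈ cone S, v ≠ 0 → eval v f = 0) :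
    ∀ v ∈ cone S, eval v f = 0 := by
  intro v hv
  rcases eq_or_ne v 0 with rfl | h0
  · obtain ⟨p, hp⟩ := hS
    have hl : line p.rep f = 0 := by
      refine Polynomial.eq_zero_of_infinite_isRoot _ (Set.Infinite.mono (s := {0}ᶜ) ?_
        (Set.finite_singleton _).infinite_compl)
      intro c hc
      exact (eval_line _ f c).trans
        (h _ (smul_mem_cone (rep_mem_cone.2 hp) c) (smul_ne_zero hc p.rep_nonzero))
    rw [← zero_smul k p.rep, ← eval_line, hl, Polynomial.eval_zero]
  · exact h v hv h0

theorem isClosed_V0 {f : MvPolynomial (Fin n) k} {d : ℕ} (hf : f.IsHomogeneous d) :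
    IsClosed (V0 f) :=
  ⟨TopologicalSpace.isOpen_generateFrom_of_mem ⟨d, f, hf, rfl⟩⟩

theorem isTopologicalBasis_V0 : TopologicalSpace.IsTopologicalBasis
    {U : Set (PS k n) | ∃ (d : ℕ) (f : MvPolynomial (Fin n) k), f.IsHomogeneous d ∧
      U = (V0 f)ᶜ} := by
  refine TopologicalSpace.isTopologicalBasis_of_subbasis_of_finiteInter rfl ⟨?_, ?_⟩
  · refine ⟨0, 1, isHomogeneous_one _ _, ?_⟩
    ext p
    induction p using Projectivization.ind with
    | h v hv => simp [mk_mem_V0 (isHomogeneous_one (Fin n) k) hv]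
  · rintro _ ⟨d, f, hf, rfl⟩ _ ⟨e, g, hg, rfl⟩
    refine ⟨d + e, f * g, hf.mul hg, ?_⟩
    ext p
    induction p using Projectivization.ind with
    | h v hv => simp [mk_mem_V0 hf hv, mk_mem_V0 hg hv, mk_mem_V0 (hf.mul hg) hv]

theorem exists_eval_ne_zero_of_mem_isOpen {U : Set (PS k n)} (hU : IsOpen U) {v : Fin n → k}
    {hv : v ≠ 0} (h : Projectivization.mk k v hv ∈ U) :
    ∃ d, ∃ f : MvPolynomial (Fin n) k, f.IsHomogeneous d ∧ eval v f ≠ 0 ∧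
      ∀ w (hw : w ≠ 0), eval w f ≠ 0 → Projectivization.mk k w hw ∈ U := by
  obtain ⟨_, ⟨d, f, hf, rfl⟩, hvf, hfU⟩ := isTopologicalBasis_V0.exists_subset_of_mem_open h hU
  exact ⟨d, f, hf, fun h0 => hvf ((mk_mem_V0 hf hv).2 h0),
    fun w hw hwf => hfU fun h0 => hwf ((mk_mem_V0 hf hw).1 h0)⟩

theorem mk_mem_closure [Infinite k] {S : Set (PS k n)} (hS : S.Nonempty) {v : Fin n → k}
    (hv : v ≠ 0) : Projectivization.mk k v hv ∈ closure S ↔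
      ∀ f : MvPolynomial (Fin n) k, (∀ w ∈ cone S, eval w f = 0) → eval v f = 0 := by
  constructor
  · intro h f hf
    by_contra hvf
    obtain ⟨d, hd⟩ := exists_homogeneousComponent_ne_zero hvf
    have hh := homogeneousComponent_isHomogeneous d f
    refine hd ((mk_mem_V0 hh hv).1 (closure_minimal (fun p hp => ?_) (isClosed_V0 hh) h))
    induction p using Projectivization.ind with
    | h w hw =>
      rw [mk_mem_V0 hh hw]
      exact eval_homogeneousComponent_eq_zero
        (fun c _ => hf _ (smul_mem_cone ((mem_cone_mk hw).2 hp) c)) d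
  · intro h
    by_contra hvS
    obtain ⟨d, f, hf, hvf, hfS⟩ := exists_eval_ne_zero_of_mem_isOpen
      isClosed_closure.isOpen_compl hvS
    refine hvf (h f (eval_eq_zero_of_mem_cone hS fun w hw hw0 => ?_))
    by_contra hwf
    exact hfS w hw0 hwf (subset_closure (hw hw0))

theorem mem_cone_closure [Infinite k] {S : Set (PS k n)} (hS : S.Nonempty) {v : Fin n → k} :
    v ∈ cone (closure S) ↔
      ∀ f : MvPolynomial (Fin n) k, (∀ w ∈ cone S, eval w f = 0) → eval v f = 0 := by
  rcases eq_or_ne v 0 with rfl | hv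
  · exact ⟨fun _ f hf => hf 0 (zero_mem_cone S), fun _ => zero_mem_cone _⟩
  · rw [mem_cone_mk hv, mk_mem_closure hS hv]

theorem mem_cone_of_isClosed [Infinite k] {S : Set (PS k n)} (hS : S.Nonempty) (hc : IsClosed S)
    (v : Fin n → k)
    (h : ∀ f : MvPolynomial (Fin n) k, (∀ w ∈ cone S, eval w f = 0) → eval v f = 0) :
    v ∈ cone S := by
  rw [← hc.closure_eq, mem_cone_closure hS]
  exact h

/-- The nonvanishing of a polynomial on a line is an open condition. -/
theorem exists_isOpen_smul_eval_ne_zero [Infinite k] {v : Fin n → k} (hv : v ≠ 0)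
    {f : MvPolynomial (Fin n) k} (h : eval v f ≠ 0) : ∃ W : Set (PS k n), IsOpen W ∧
      Projectivization.mk k v hv ∈ W ∧ ∀ w (hw : w ≠ 0), Projectivization.mk k w hw ∈ W →
        ∃ c : k, c ≠ 0 ∧ eval (c • w) f ≠ 0 := by
  obtain ⟨d, hd⟩ := exists_homogeneousComponent_ne_zero h
  have hh := homogeneousComponent_isHomogeneous d f
  exact ⟨_, (isClosed_V0 hh).isOpen_compl, fun h0 => hd ((mk_mem_V0 hh hv).1 h0),
    fun w hw hwf => exists_smul_eval_ne_zero fun h0 => hwf ((mk_mem_V0 hh hw).2 h0)⟩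

theorem ZIrr.of_isIrreducible [Infinite k] {S : Set (PS k n)} (hS : IsIrreducible S) :
    ZIrr (cone S) where
  nonempty := ⟨0, zero_mem_cone S⟩
  dich f g hf hg h := by
    obtain ⟨p, hp⟩ := hf
    obtain ⟨q, hq⟩ := hg
    simp only [hp, hq] at h ⊢
    by_contra! hcon
    obtain ⟨hc1, hc2⟩ := hcon
    have key : ∀ p : MvPolynomial (Fin n) k, (∃ a ∈ cone S, eval a p ≠ 0) →
        ∃ v, ∃ hv : v ≠ 0, Projectivization.mk k v hv ∈ S ∧ eval v p ≠ 0 := by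
      intro p hp
      by_contra! hcon
      obtain ⟨a, ha, hap⟩ := hp
      exact hap (eval_eq_zero_of_mem_cone hS.1 (fun v hv hv0 => hcon v hv0 (hv hv0)) a ha)
    obtain ⟨v, hv, hvS, hvp⟩ := key p hc1
    obtain ⟨w, hw, hwS, hwq⟩ := key q hc2
    obtain ⟨W1, hW1, hvW, h1⟩ := exists_isOpen_smul_eval_ne_zero hv hvp
    obtain ⟨W2, hW2, hwW, h2⟩ := exists_isOpen_smul_eval_ne_zero hw hwq
    obtain ⟨x, hxS, hx1, hx2⟩ := hS.2 W1 W2 hW1 hW2 ⟨_, hvS, hvW⟩ ⟨_, hwS, hwW⟩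
    induction x using Projectivization.ind with
    | h x hx =>
      obtain ⟨c, _, hc⟩ := h1 x hx hx1
      obtain ⟨e, _, he⟩ := h2 x hx hx2
      have : line x p * line x q = 0 := by
        rw [← line_mul]
        refine Polynomial.funext fun a => ?_
        rw [eval_line, map_mul, Polynomial.eval_zero]
        exact h _ (smul_mem_cone ((mem_cone_mk hx).2 hxS) a)
      rcases mul_eq_zero.1 this with h0 | h0
      · exact hc (by rw [← eval_line, h0, Polynomial.eval_zero])
      · exact he (by rw [← eval_line, h0, Polynomial.eval_zero])

theorem ZIrr.isIrreducible [Infinite k] {S : Set (PS k n)} (hS : S.Nonempty)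
    (hC : ZIrr (cone S)) : IsIrreducible S := by
  refine ⟨hS, fun U1 U2 hU1 hU2 ⟨x, hxS, hx⟩ ⟨y, hyS, hy⟩ => ?_⟩
  induction x using Projectivization.ind with
  | h x hx0 =>
  induction y using Projectivization.ind with
  | h y hy0 =>
    obtain ⟨_, f, -, hxf, hf⟩ := exists_eval_ne_zero_of_mem_isOpen hU1 hx
    obtain ⟨_, g, -, hyg, hg⟩ := exists_eval_ne_zero_of_mem_isOpen hU2 hy
    by_contra hcon
    have hfg : ∀ v ∈ cone S, eval v (f * g) = 0 := by
      refine eval_eq_zero_of_mem_cone hS fun v hv hv0 => ?_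
      rw [map_mul]
      by_contra hv1
      exact hcon ⟨_, hv hv0, hf v hv0 (left_ne_zero_of_mul hv1),
        hg v hv0 (right_ne_zero_of_mul hv1)⟩
    rcases hC.dich _ _ (.eval f) (.eval g) (fun a ha => by simpa using hfg a ha) with h | h
    · exact hxf (h x fun _ => hxS)
    · exact hyg (h y fun _ => hyS)

theorem mk_mem_linSet {W : Submodule k (Fin n → k)} {v : Fin n → k} (hv : v ≠ 0) :
    Projectivization.mk k v hv ∈ linSet W ↔ v ∈ W := by
  simp [linSet, Projectivization.submodule_mk, Submodule.span_singleton_le_iff_mem]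

theorem cone_linSet (W : Submodule k (Fin n → k)) : cone (linSet W) = W := by
  ext v
  rcases eq_or_ne v 0 with rfl | hv
  · simp [zero_mem_cone]
  · rw [mem_cone_mk hv, mk_mem_linSet hv]; rfl

theorem ZIrr.submodule [Infinite k] (W : Submodule k (Fin n → k)) :
    ZIrr (W : Set (Fin n → k)) := by
  obtain ⟨f, hf⟩ := W.subtype.exists_leftInverse_of_injective W.ker_subtype
  have := (ZIrr.univ (k := k) (σ := Fin n)).image (φ := W.subtype ∘ₗ f)
    fun j => IsPolyFun.linear (LinearMap.proj j ∘ₗ W.subtype ∘ₗ f)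
  convert this
  ext v
  simp only [SetLike.mem_coe, LinearMap.coe_comp, Set.mem_image, Set.mem_univ, true_and]
  refine ⟨fun hv => ⟨v, ?_⟩, ?_⟩
  · simpa using congrArg W.subtype (LinearMap.congr_fun hf ⟨v, hv⟩)
  · rintro ⟨x, rfl⟩
    exact (f x).2

theorem isIrreducible_linSet [Infinite k] {W : Submodule k (Fin n → k)}
    (hW : (linSet W).Nonempty) : IsIrreducible (linSet W) :=
  ZIrr.isIrreducible hW (by rw [cone_linSet]; exact .submodule W)

theorem isClosed_linSet [Infinite k] (W : Submodule k (Fin n → k)) : IsClosed (linSet W) := by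
  rcases (linSet W).eq_empty_or_nonempty with h | h
  · rw [h]; exact isClosed_empty
  refine isClosed_of_closure_subset fun p hp => ?_
  induction p using Projectivization.ind with
  | h v hv =>
    rw [mk_mem_closure h hv, cone_linSet] at hp
    rw [mk_mem_linSet hv]
    by_contra hvW
    obtain ⟨f, hfv, hf⟩ := Submodule.exists_le_ker_of_notMem hvW
    obtain ⟨p, hpf⟩ := IsPolyFun.linear f
    exact hfv ((hpf v).trans (hp p fun w hw => (hpf w).symm.trans (hf hw)))

/-- A linear form, as a polynomial. -/
def linPoly (f : (Fin n → k) →ₗ[k] k) : MvPolynomial (Fin n) k :=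
  ∑ i, C (f (Pi.single i 1)) * X i

theorem isHomogeneous_linPoly (f : (Fin n → k) →ₗ[k] k) : (linPoly f).IsHomogeneous 1 :=
  IsHomogeneous.sum _ _ _ fun i _ => by
    simpa using (isHomogeneous_C (Fin n) (f (Pi.single i 1))).mul (isHomogeneous_X k i)

theorem eval_linPoly (f : (Fin n → k) →ₗ[k] k) (v : Fin n → k) : eval v (linPoly f) = f v := by
  rw [LinearMap.pi_apply_eq_sum_univ f v, linPoly, map_sum]
  refine Finset.sum_congr rfl fun i _ => ?_
  rw [map_mul, eval_C, eval_X, smul_eq_mul, mul_comm]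
  congr 2
  ext j
  simp [Pi.single_apply, eq_comm]

end Cone

section Dimension

theorem topologicalKrullDim_lt_of_ssubset {T : Type} [TopologicalSpace T] {A B : Set T}
    (hA : IsClosed A) (hBi : IsIrreducible B) (hAB : A ⊂ B) {m : ℕ}
    (h : topologicalKrullDim B < ((m + 1 : ℕ) : WithBot ℕ∞)) :
    topologicalKrullDim A < (m : WithBot ℕ∞) := by
  by_contra! hcon
  rw [topologicalKrullDim] at hcon
  obtain ⟨p, hp⟩ := Order.le_krullDim_iff.1 hcon
  have hι : Topology.IsInducing (Set.inclusion hAB.1) :=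
    (Topology.IsEmbedding.inclusion hAB.1).isInducing
  let q := p.map _ (TopologicalSpace.IrreducibleCloseds.map_strictMono_of_isInducing hι)
  have hBu : IsIrreducible (Set.univ : Set B) := by
    have := isIrreducible_iff_irreducibleSpace.1 hBi
    exact IrreducibleSpace.isIrreducible_univ B
  let top : TopologicalSpace.IrreducibleCloseds B := ⟨Set.univ, hBu, isClosed_univ⟩
  have hq : q.last < top := by
    obtain ⟨x, hxB, hxA⟩ := Set.exists_of_ssubset hAB
    have hlt : (q.last : Set B) ⊆ {y | (y : T) ∈ A} := by
      change (TopologicalSpace.IrreducibleCloseds.map _ hι.continuous p.last : Set B) ⊆ _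
      rw [TopologicalSpace.IrreducibleCloseds.coe_map]
      refine closure_minimal ?_ (hA.preimage continuous_subtype_val)
      rintro _ ⟨y, -, rfl⟩
      exact y.2
    refine lt_of_le_of_ne (fun y _ => trivial) fun heq => hxA ?_
    have : (⟨x, hxB⟩ : B) ∈ (q.last : Set B) := by rw [heq]; trivial
    exact hlt this
  have := Order.LTSeries.length_le_krullDim (q.snoc top hq)
  rw [RelSeries.snoc_length] at this
  have hl : q.length = m := hp
  rw [hl] at this
  exact absurd h (not_lt.2 this)

variable {k : Type} [Field k] {n : ℕ}

theorem pdim_mono {A B : Set (PS k n)} (h : A ⊆ B) : pdim A ≤ pdim B :=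
  (Topology.IsEmbedding.inclusion h).isInducing.topologicalKrullDim_le

theorem eq_of_subset_of_pdim_le {A B : Set (PS k n)} (hA : IsClosed A)
    (hBi : IsIrreducible B) (hAB : A ⊆ B) {m : ℕ} (hBm : pdim B = (m : WithBot ℕ∞))
    (hAm : (m : WithBot ℕ∞) ≤ pdim A) : A = B := by
  by_contra hne
  refine absurd (topologicalKrullDim_lt_of_ssubset (m := m) hA hBi
    (Set.ssubset_iff_subset_ne.2 ⟨hAB, hne⟩) ?_) (not_lt.2 hAm)
  change pdim B < _
  rw [hBm]
  exact_mod_cast Nat.lt_succ_self m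

theorem pdim_lt_of_ssubset {A B : Set (PS k n)} (hA : IsClosed A)
    (hBi : IsIrreducible B) (hAB : A ⊂ B) {m : ℕ} (hBm : pdim B = (m : WithBot ℕ∞)) :
    pdim A < m := by
  refine topologicalKrullDim_lt_of_ssubset hA hBi hAB ?_
  change pdim B < _
  rw [hBm]
  exact_mod_cast Nat.lt_succ_self m

instance [Infinite k] : TopologicalSpace.NoetherianSpace (PS k n) := by
  refine ((TopologicalSpace.noetherianSpace_TFAE (PS k n)).out 0 1).2 ?_
  refine StrictAnti.wellFoundedLT (β := Ideal (MvPolynomial (Fin n) k))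
    (f := fun Z => vanishingIdeal k (cone (Z : Set (PS k n)))) fun A B hAB => ?_
  have hle : (vanishingIdeal k (cone (B : Set (PS k n))) : Ideal (MvPolynomial (Fin n) k)) ≤
      vanishingIdeal k (cone (A : Set (PS k n))) := fun f hf => by
    rw [mem_vanishingIdeal_iff] at hf ⊢
    exact fun v hv => hf v (cone_mono hAB.le hv)
  refine lt_of_le_of_ne hle fun heq => hAB.not_ge ?_
  refine subset_of_cone_subset fun v hv => ?_
  rcases (A : Set (PS k n)).eq_empty_or_nonempty with hA | hA
  · intro hv0
    have hX : ∀ i, (X i : MvPolynomial (Fin n) k) ∈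
        (vanishingIdeal k (cone (A : Set (PS k n))) : Ideal (MvPolynomial (Fin n) k)) := by
      intro i
      rw [mem_vanishingIdeal_iff]
      intro w hw
      rcases eq_or_ne w 0 with rfl | h0
      · simp
      · exact absurd (hw h0) (by simp [hA])
    simp only [← heq, mem_vanishingIdeal_iff] at hX
    exact absurd (funext fun i => by simpa using hX i v hv) hv0
  · refine mem_cone_of_isClosed hA A.isClosed v fun f hf => ?_
    have : f ∈ (vanishingIdeal k (cone (A : Set (PS k n))) : Ideal (MvPolynomial (Fin n) k)) := by
      rw [mem_vanishingIdeal_iff]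
      simpa [MvPolynomial.aeval_eq_eval] using hf
    rw [show vanishingIdeal k (cone (A : Set (PS k n))) = vanishingIdeal k (cone (B : Set (PS k n)))
      from heq.symm, mem_vanishingIdeal_iff] at this
    simpa [MvPolynomial.aeval_eq_eval] using this v hv

instance [Infinite k] : T1Space (PS k n) where
  t1 p := by
    convert isClosed_linSet p.submodule
    ext q
    rw [Set.mem_singleton_iff]
    induction p using Projectivization.ind with
    | h v hv =>
    induction q using Projectivization.ind with
    | h w hw =>
      rw [mk_mem_linSet, Projectivization.submodule_mk, Submodule.mem_span_singleton,
        Projectivization.mk_eq_mk_iff']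

theorem infinite_of_isIrreducible {T : Type} [TopologicalSpace T] [T1Space T] {S : Set T}
    (hS : IsIrreducible S) {x y : T} (hx : x ∈ S) (hy : y ∈ S) (hxy : x ≠ y) : S.Infinite := by
  intro hfin
  obtain ⟨z, hzS, hz1, hz2⟩ := hS.2 {x}ᶜ (S \ {x})ᶜ isClosed_singleton.isOpen_compl
    (hfin.sdiff).isClosed.isOpen_compl ⟨y, hy, hxy.symm⟩ ⟨x, hx, fun h => h.2 rfl⟩
  exact hz2 ⟨hzS, hz1⟩

/-- Finitely many closed irreducible sets of dimension less than `m` are missed by the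
intersection of suitable `m` hyperplanes. -/
theorem exists_linear_forms_of_finite [Infinite k] (m : ℕ) (S : Set (Set (PS k n))) (hS : S.Finite)
    (hSc : ∀ Z ∈ S, IsClosed Z) (hSi : ∀ Z ∈ S, IsIrreducible Z) (hSd : ∀ Z ∈ S, pdim Z < m) :
    ∃ g : Fin m → (Fin n → k) →ₗ[k] k, ∀ Z ∈ S, ∀ v ∈ cone Z, (∀ i, g i v = 0) → v = 0 := by
  induction m generalizing S with
  | zero =>
    refine ⟨Fin.elim0, fun Z hZ => absurd (hSd Z hZ) (not_lt.2 ?_)⟩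
    have : Nonempty (TopologicalSpace.IrreducibleCloseds Z) := by
      have := isIrreducible_iff_irreducibleSpace.1 (hSi Z hZ)
      exact ⟨⟨Set.univ, IrreducibleSpace.isIrreducible_univ Z, isClosed_univ⟩⟩
    exact_mod_cast Order.krullDim_nonneg
  | succ m ih =>
    have hfin : Finite S := hS
    choose x hx using fun Z : S => (hSi Z Z.2).1
    obtain ⟨f, hf⟩ := Module.exists_dual_forall_apply_ne_zero (K := k) (fun Z : S => (x Z).rep)
      fun Z => (x Z).rep_nonzero
    have hcl : ∀ Z : S, IsClosed ((Z : Set (PS k n)) ∩ linSet (LinearMap.ker f)) := fun Z =>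
      (hSc Z Z.2).inter (isClosed_linSet _)
    choose T hTf hTc hTi hT using fun Z : S =>
      TopologicalSpace.NoetherianSpace.exists_finite_set_isClosed_irreducible (hcl Z)
    obtain ⟨g, hg⟩ := ih (⋃ Z, T Z) (Set.finite_iUnion hTf)
      (by simpa using fun t Z hZ ht => hTc ⟨Z, hZ⟩ t ht)
      (by simpa using fun t Z hZ ht => hTi ⟨Z, hZ⟩ t ht) (by
        intro t ht
        obtain ⟨Z, htZ⟩ := Set.mem_iUnion.1 ht
        have hsub : t ⊆ (Z : Set (PS k n)) ∩ linSet (LinearMap.ker f) := by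
          rw [hT]; exact Set.subset_sUnion_of_mem htZ
        refine (pdim_mono hsub).trans_lt (topologicalKrullDim_lt_of_ssubset (hcl Z) (hSi Z Z.2)
          ⟨Set.inter_subset_left, fun h => hf Z ?_⟩ (hSd Z Z.2))
        have h1 := (h (hx Z)).2
        rw [← (x Z).mk_rep, mk_mem_linSet] at h1
        exact h1)
    refine ⟨Fin.cons f g, fun Z hZ v hv hv0 => ?_⟩
    by_contra hne
    have hvf : Projectivization.mk k v hne ∈ Z ∩ linSet (LinearMap.ker f) :=
      ⟨hv hne, (mk_mem_linSet hne).2 (by simpa using hv0 0)⟩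
    rw [hT ⟨Z, hZ⟩] at hvf
    obtain ⟨t, ht, hvt⟩ := hvf
    exact hne (hg t (Set.mem_iUnion.2 ⟨_, ht⟩) v (fun _ => hvt) fun i => by simpa using hv0 i.succ)

end Dimension

section Secant

variable {k : Type} [Field k] {n : ℕ}

/-- The vectors that are sums of `t` elements of `C`. -/
def sumSet (C : Set (Fin n → k)) (t : ℕ) : Set (Fin n → k) :=
  {v | ∃ a : Fin t → Fin n → k, (∀ i, a i ∈ C) ∧ v = ∑ i, a i}

theorem mem_sumSet_zero {C : Set (Fin n → k)} {v : Fin n → k} : v ∈ sumSet C 0 ↔ v = 0 := by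
  simp [sumSet]

theorem mem_sumSet_succ {C : Set (Fin n → k)} {t : ℕ} {v : Fin n → k} :
    v ∈ sumSet C (t + 1) ↔ ∃ a ∈ C, ∃ b ∈ sumSet C t, v = a + b := by
  constructor
  · rintro ⟨a, ha, rfl⟩
    exact ⟨a 0, ha 0, _, ⟨fun i => a i.succ, fun i => ha _, rfl⟩, Fin.sum_univ_succ a⟩
  · rintro ⟨a, ha, _, ⟨b, hb, rfl⟩, rfl⟩
    exact ⟨Fin.cons a b, fun i => by cases i using Fin.cases <;> simp [ha, hb],
      by simp [Fin.sum_univ_succ]⟩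

theorem sumSet_mono {C : Set (Fin n → k)} (h0 : 0 ∈ C) : Monotone (sumSet C) :=
  monotone_nat_of_le_succ fun _ v hv => mem_sumSet_succ.2 ⟨0, h0, v, hv, (zero_add v).symm⟩

theorem zero_mem_sumSet {C : Set (Fin n → k)} (h0 : 0 ∈ C) (t : ℕ) : 0 ∈ sumSet C t :=
  ⟨0, fun _ => h0, by simp⟩

theorem smul_mem_sumSet {S : Set (PS k n)} {t : ℕ} {v : Fin n → k} (hv : v ∈ sumSet (cone S) t)
    (c : k) : c • v ∈ sumSet (cone S) t := by
  obtain ⟨a, ha, rfl⟩ := hv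
  exact ⟨fun i => c • a i, fun i => smul_mem_cone (ha i) c, Finset.smul_sum⟩

theorem ZIrr.sumSet {C : Set (Fin n → k)} (hC : ZIrr C) (t : ℕ) : ZIrr (sumSet C t) := by
  convert (hC.pow t).image (φ := fun c j => ∑ i, c (i, j))
    fun j => .sum _ fun i => .coord (i, j)
  ext v
  constructor
  · rintro ⟨a, ha, rfl⟩
    exact ⟨fun x => a x.1 x.2, ha, by ext; simp⟩
  · rintro ⟨c, hc, rfl⟩
    exact ⟨fun i j => c (i, j), hc, by ext; simp⟩

theorem memSpan_mk {v : Fin n → k} (hv : v ≠ 0) {S : Set (PS k n)} :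
    memSpan (Projectivization.mk k v hv) S ↔ v ∈ pspan S := by
  simp [memSpan, Projectivization.submodule_mk, Submodule.span_singleton_le_iff_mem]

theorem pspan_mono {S T : Set (PS k n)} (h : S ⊆ T) : pspan S ≤ pspan T :=
  biSup_mono h

theorem pspan_eq_span (S : Set (PS k n)) : pspan S = Submodule.span k (cone S) := by
  apply le_antisymm
  · refine iSup₂_le fun p hp => ?_
    rw [p.submodule_eq, Submodule.span_singleton_le_iff_mem]
    exact Submodule.subset_span (rep_mem_cone.2 hp)
  · refine Submodule.span_le.2 fun v hv => ?_
    rcases eq_or_ne v 0 with rfl | h0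
    · exact zero_mem _
    · refine (le_iSup₂_of_le (f := fun p (_ : p ∈ S) => p.submodule) _ (hv h0) le_rfl) ?_
      rw [Projectivization.submodule_mk]
      exact Submodule.mem_span_singleton_self v

theorem cone_subset_pspan (S : Set (PS k n)) : cone S ⊆ pspan S := by
  rw [pspan_eq_span]
  exact Submodule.subset_span

theorem subset_linSet_pspan (S : Set (PS k n)) : S ⊆ linSet (pspan S) :=
  subset_of_cone_subset (by rw [cone_linSet]; exact cone_subset_pspan S)

theorem isIrreducible_linSet_pspan [Infinite k] {S : Set (PS k n)} (hS : S.Nonempty) :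
    IsIrreducible (linSet (pspan S)) :=
  isIrreducible_linSet (hS.mono (subset_linSet_pspan S))

theorem sumSet_subset_pspan (S : Set (PS k n)) (t : ℕ) : sumSet (cone S) t ⊆ pspan S := by
  rintro _ ⟨a, ha, rfl⟩
  exact Submodule.sum_mem _ fun i _ => cone_subset_pspan S (ha i)

theorem pspan_insert (p : PS k n) (S : Set (PS k n)) : pspan (insert p S) = p.submodule ⊔ pspan S :=
  iSup_insert

theorem mem_pspan_insert {p : PS k n} {S : Set (PS k n)} {v : Fin n → k} :
    v ∈ pspan (insert p S) ↔ ∃ c : k, ∃ b ∈ pspan S, v = c • p.rep + b := by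
  rw [pspan_insert, Submodule.mem_sup, p.submodule_eq]
  simp only [Submodule.mem_span_singleton, exists_exists_eq_and, eq_comm (b := v)]

theorem mem_sumSet_of_mem_pspan {X : Set (PS k n)} (A : Finset (PS k n)) (hA : ↑A ⊆ X)
    {v : Fin n → k} (hv : v ∈ pspan (A : Set (PS k n))) : v ∈ sumSet (cone X) A.card := by
  classical
  induction A using Finset.induction_on generalizing v with
  | empty => simpa [pspan, mem_sumSet_zero] using hv
  | insert p A hp ih =>
    rw [Finset.coe_insert] at hv hA
    obtain ⟨c, b, hb, rfl⟩ := mem_pspan_insert.1 hv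
    rw [Finset.card_insert_of_notMem hp]
    exact mem_sumSet_succ.2 ⟨_, smul_mem_cone (rep_mem_cone.2 (hA (Set.mem_insert _ _))) c, b,
      ih ((Set.subset_insert _ _).trans hA) hb, rfl⟩

theorem exists_finset_of_mem_sumSet {X : Set (PS k n)} {t : ℕ} {v : Fin n → k}
    (hv : v ∈ sumSet (cone X) t) :
    ∃ A : Finset (PS k n), ↑A ⊆ X ∧ A.card ≤ t ∧ v ∈ pspan (A : Set (PS k n)) := by
  classical
  induction t generalizing v with
  | zero => exact ⟨∅, by simp, by simp, by rw [mem_sumSet_zero.1 hv]; exact zero_mem _⟩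
  | succ t ih =>
    obtain ⟨a, ha, b, hb, rfl⟩ := mem_sumSet_succ.1 hv
    obtain ⟨A, hAX, hAt, hbA⟩ := ih hb
    rcases eq_or_ne a 0 with rfl | h0
    · exact ⟨A, hAX, by lia, by simpa using hbA⟩
    · refine ⟨insert (Projectivization.mk k a h0) A, ?_, (Finset.card_insert_le _ _).trans (by lia),
        ?_⟩
      · rw [Finset.coe_insert]
        exact Set.insert_subset (ha h0) hAX
      · rw [Finset.coe_insert, pspan_insert, Projectivization.submodule_mk]
        exact add_mem (Submodule.mem_sup_left (Submodule.mem_span_singleton_self a))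
          (Submodule.mem_sup_right hbA)

theorem hasDecomp_mk {X : Set (PS k n)} (hX : X.Infinite) {t : ℕ} {v : Fin n → k} (hv : v ≠ 0) :
    hasDecomp X (Projectivization.mk k v hv) t ↔ v ∈ sumSet (cone X) t := by
  constructor
  · rintro ⟨A, hA, rfl, hvA⟩
    exact mem_sumSet_of_mem_pspan A hA ((memSpan_mk hv).1 hvA)
  · intro h
    obtain ⟨A, hA, hAt, hvA⟩ := exists_finset_of_mem_sumSet h
    obtain ⟨B, hAB, hBX, rfl⟩ := hX.exists_superset_ncard_eq hA A.finite_toSet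
      (k := t) (by simpa using hAt)
    by_cases hB : B.Finite
    · lift B to Finset (PS k n) using hB
      exact ⟨B, hBX, by simp, (memSpan_mk hv).2 (pspan_mono hAB hvA)⟩
    · rw [Set.Infinite.ncard hB] at hAt h
      rw [Set.Infinite.ncard hB]
      exact ⟨A, hA, by lia, (memSpan_mk hv).2 hvA⟩

theorem cone_hasDecomp {X : Set (PS k n)} (hX : X.Infinite) (t : ℕ) :
    cone {q | hasDecomp X q t} = sumSet (cone X) t := by
  ext v
  rcases eq_or_ne v 0 with rfl | hv
  · simp [zero_mem_cone, zero_mem_sumSet (zero_mem_cone X)]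
  · rw [mem_cone_mk hv, Set.mem_ofPred_eq, hasDecomp_mk hX hv]

theorem setOf_hasDecomp_mono {X : Set (PS k n)} (hX : X.Infinite) :
    Monotone fun t => {q | hasDecomp X q t} := fun a b hab => by
  apply subset_of_cone_subset
  rw [cone_hasDecomp hX, cone_hasDecomp hX]
  exact sumSet_mono (zero_mem_cone X) hab

theorem subset_setOf_hasDecomp {X : Set (PS k n)} (hX : X.Infinite) {t : ℕ} (ht : 1 ≤ t) :
    X ⊆ {q | hasDecomp X q t} := by
  apply subset_of_cone_subset
  rw [cone_hasDecomp hX]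
  exact fun v hv => sumSet_mono (zero_mem_cone X) ht (mem_sumSet_succ.2
    ⟨v, hv, 0, mem_sumSet_zero.2 rfl, (add_zero v).symm⟩)

theorem hasDecomp_mono_left {X Y : Set (PS k n)} (h : X ⊆ Y) {q : PS k n} {t : ℕ}
    (hq : hasDecomp X q t) : hasDecomp Y q t := by
  obtain ⟨A, hA, hq⟩ := hq
  exact ⟨A, hA.trans h, hq⟩

theorem secant_mono_left {X Y : Set (PS k n)} (h : X ⊆ Y) (t : ℕ) : secant X t ⊆ secant Y t :=
  closure_mono fun _ => hasDecomp_mono_left h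

theorem secant_subset_linSet [Infinite k] (X : Set (PS k n)) (t : ℕ) :
    secant X t ⊆ linSet (pspan X) :=
  closure_minimal (fun _ ⟨_, hA, _, hq⟩ => hq.trans (pspan_mono hA)) (isClosed_linSet _)

theorem isIrreducible_secant [Infinite k] {X : Set (PS k n)} (hX : X.Infinite)
    (hXi : IsIrreducible X) {t : ℕ} (ht : 1 ≤ t) : IsIrreducible (secant X t) := by
  refine IsIrreducible.closure (ZIrr.isIrreducible (hXi.1.mono (subset_setOf_hasDecomp hX ht)) ?_)
  rw [cone_hasDecomp hX]
  exact (ZIrr.of_isIrreducible hXi).sumSet t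

theorem mem_cone_secant [Infinite k] {X : Set (PS k n)} (hX : X.Infinite)
    {t : ℕ} (ht : 1 ≤ t) {v : Fin n → k} : v ∈ cone (secant X t) ↔
      ∀ f : MvPolynomial (Fin n) k, (∀ w ∈ sumSet (cone X) t, eval w f = 0) → eval v f = 0 := by
  rw [secant, mem_cone_closure (hX.nonempty.mono (subset_setOf_hasDecomp hX ht)), cone_hasDecomp hX]

theorem secant_eq_linSet [Infinite k] {X : Set (PS k n)} (hX : X.Infinite) {t : ℕ}
    (ht : Module.finrank k (pspan X) ≤ t) : secant X t = linSet (pspan X) := by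
  refine (secant_subset_linSet X t).antisymm (Set.Subset.trans ?_ subset_closure)
  apply subset_of_cone_subset
  rw [cone_hasDecomp hX, cone_linSet]
  refine Set.Subset.trans ?_ (sumSet_mono (zero_mem_cone X) ht)
  rw [pspan_eq_span]
  obtain ⟨f, hf, hspan, -⟩ := Submodule.exists_fun_fin_finrank_span_eq k (cone X)
  intro v hv
  rw [SetLike.mem_coe, ← hspan, Submodule.mem_span_range_iff_exists_fun] at hv
  obtain ⟨c, rfl⟩ := hv
  exact ⟨fun i => c i • f i, fun i => smul_mem_cone (hf i) _, rfl⟩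

end Secant

section Independence

variable {k : Type} [Field k] {n : ℕ}

attribute [local instance] MvPolynomial.gradedAlgebra in
theorem homogeneousComponent_mul_of_isHomogeneous {f g : MvPolynomial (Fin n) k} {d e : ℕ}
    (hg : g.IsHomogeneous e) :
    homogeneousComponent (d + e) (f * g) = homogeneousComponent d f * g := by
  have := DirectSum.coe_decompose_mul_of_right_mem_of_le (homogeneousSubmodule (Fin n) k)
    (a := f) (n := d + e) ((mem_homogeneousSubmodule e g).2 hg) (Nat.le_add_left e d)
  rw [Nat.add_sub_cancel] at this
  exact (decomposition.decompose'_apply _ _).symm.trans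
    (this.trans (congrArg (· * g) (decomposition.decompose'_apply _ _)))

theorem finite_of_X_mem_radical {I : Ideal (MvPolynomial (Fin n) k)}
    (hI : ∀ f ∈ I, ∀ d, homogeneousComponent d f ∈ I) {m : ℕ}
    {G : Fin m → MvPolynomial (Fin n) k} (hG : ∀ j, (G j).IsHomogeneous 1)
    (hrad : ∀ i, X i ∈ (I ⊔ Ideal.span (Set.range G)).radical) :
    Module.Finite (Algebra.adjoin k (Set.range fun j => Ideal.Quotient.mk I (G j)))
      (MvPolynomial (Fin n) k ⧸ I) := by
  choose N hN using hrad
  have hpow : ∀ i, ∃ h : Fin m → MvPolynomial (Fin n) k, (∀ j, (h j).totalDegree ≤ ∑ i, N i) ∧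
      X i ^ (∑ i, N i + 1) - ∑ j, h j * G j ∈ I := by
    intro i
    have hi : X i ^ (∑ i, N i + 1) ∈ I ⊔ Ideal.span (Set.range G) :=
      Ideal.pow_mem_of_pow_mem _ (hN i) ((Finset.single_le_sum (fun _ _ => Nat.zero_le _)
        (Finset.mem_univ i)).trans (Nat.le_succ _))
    obtain ⟨a, ha, b, hb, hab⟩ := Submodule.mem_sup.1 hi
    obtain ⟨c, rfl⟩ := Ideal.mem_span_range_iff_exists_fun.1 hb
    refine ⟨fun j => homogeneousComponent (∑ i, N i) (c j), fun j =>
      (homogeneousComponent_isHomogeneous _ _).totalDegree_le, ?_⟩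
    have := congrArg (homogeneousComponent (∑ i, N i + 1)) hab
    rw [homogeneousComponent_eq_self (isHomogeneous_X_pow i _), map_add, map_sum] at this
    simp_rw [homogeneousComponent_mul_of_isHomogeneous (hG _)] at this
    rw [← this, add_sub_cancel_right]
    exact hI a ha _
  choose h hdeg hmem using hpow
  set B := Algebra.adjoin k (Set.range fun j => Ideal.Quotient.mk I (G j))
  let T : Set (MvPolynomial (Fin n) k ⧸ I) :=
    (fun e : Fin n →₀ ℕ => Ideal.Quotient.mk I (monomial e 1)) ''
      {e | e.degree ≤ n * ∑ i, N i}
  have hT : T.Finite := (Finsupp.finite_of_degree_le _).image _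
  have hmain : ∀ d, ∀ p : MvPolynomial (Fin n) k, p.totalDegree ≤ d →
      Ideal.Quotient.mk I p ∈ Submodule.span B T := by
    intro d
    induction d using Nat.strong_induction_on with
    | _ d ih =>
      intro p hp
      rw [p.as_sum, map_sum]
      refine Submodule.sum_mem _ fun e he => ?_
      have hed : e.degree ≤ d := (le_totalDegree he).trans hp
      have hk : Ideal.Quotient.mk I (monomial e (coeff e p)) =
          algebraMap k B (coeff e p) • Ideal.Quotient.mk I (monomial e 1) := by
        change _ = algebraMap k (MvPolynomial (Fin n) k ⧸ I) (coeff e p) * _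
        rw [← Ideal.Quotient.mk_algebraMap, ← map_mul, algebraMap_eq, C_mul_monomial, mul_one]
      rw [hk]
      refine Submodule.smul_mem _ _ ?_
      by_cases hsmall : e.degree ≤ n * ∑ i, N i
      · exact Submodule.subset_span ⟨e, hsmall, rfl⟩
      obtain ⟨i, hi⟩ : ∃ i, ∑ i, N i + 1 ≤ e i := by
        by_contra! hcon
        refine hsmall ?_
        rw [Finsupp.degree_eq_sum]
        exact (Finset.sum_le_card_nsmul _ _ _ fun i _ => Nat.lt_succ_iff.1 (hcon i)).trans
          (by simp)
      set e' := e - Finsupp.single i (∑ i, N i + 1)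
      have he' : e' + Finsupp.single i (∑ i, N i + 1) = e :=
        tsub_add_cancel_of_le (Finsupp.single_le_iff.2 hi)
      have hdeg' : e'.degree + (∑ i, N i + 1) = e.degree := by
        rw [← he', map_add, Finsupp.degree_single]
      have hmon : Ideal.Quotient.mk I (monomial e 1) =
          ∑ j, Ideal.Quotient.mk I (G j) * Ideal.Quotient.mk I (monomial e' 1 * h i j) := by
        rw [← he', ← mul_one (1 : k), ← monomial_mul, ← X_pow_eq_monomial, mul_one]
        simp_rw [← map_mul]
        rw [← map_sum, Ideal.Quotient.eq]
        have : monomial e' (1 : k) * X i ^ (∑ i, N i + 1) - ∑ j, G j * (monomial e' 1 * h i j) =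
            monomial e' 1 * (X i ^ (∑ i, N i + 1) - ∑ j, h i j * G j) := by
          rw [mul_sub, Finset.mul_sum]
          congr 1
          exact Finset.sum_congr rfl fun j _ => by ring
        rw [this]
        exact I.mul_mem_left _ (hmem i)
      rw [hmon]
      refine Submodule.sum_mem _ fun j _ => ?_
      refine Submodule.smul_mem _ (⟨_, Algebra.subset_adjoin ⟨j, rfl⟩⟩ : B)
        (ih (e'.degree + ∑ i, N i) (by omega) _ ?_)
      exact (totalDegree_mul _ _).trans (Nat.add_le_add (totalDegree_monomial_le _ _) (hdeg i j))
  refine ⟨⟨hT.toFinset, ?_⟩⟩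
  rw [Set.Finite.coe_toFinset, eq_top_iff]
  intro x _
  obtain ⟨p, rfl⟩ := Ideal.Quotient.mk_surjective x
  exact hmain _ p le_rfl

theorem le_of_linear_forms [IsAlgClosed k] {H : Set (PS k n)} (hHc : IsClosed H)
    (hHi : IsIrreducible H) {m l : ℕ} (g : Fin m → (Fin n → k) →ₗ[k] k)
    (hg : ∀ v ∈ cone H, (∀ i, g i v = 0) → v = 0) (y : Fin l → (Fin n → k) →ₗ[k] k)
    (hy : ∀ P : MvPolynomial (Fin l) k,
      (∀ v ∈ cone H, eval (fun j => y j v) P = 0) → P = 0) : l ≤ m := by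
  have : Infinite k := IsAlgClosed.instInfinite
  have hZ : ZIrr (cone H) := ZIrr.of_isIrreducible hHi
  let I := vanishingIdeal k (cone H)
  have hI : ∀ f, f ∈ I ↔ ∀ v ∈ cone H, eval v f = 0 := fun f => by
    simp [I, mem_vanishingIdeal_iff, aeval_eq_eval]
  have hprime : I.IsPrime := by
    refine ⟨fun h => ?_, fun {f f'} hff' => ?_⟩
    · obtain ⟨v, hv⟩ := hZ.nonempty
      simpa using (hI 1).1 (h ▸ trivial) v hv
    · rw [hI] at hff'
      rw [hI, hI]
      exact hZ.dich _ _ (.eval f) (.eval f') fun v hv => by simpa using hff' v hv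
  have hfin : Module.Finite (Algebra.adjoin k (Set.range fun j =>
      Ideal.Quotient.mk I (linPoly (g j)))) (MvPolynomial (Fin n) k ⧸ I) := by
    refine finite_of_X_mem_radical (fun f hf d => ?_) (fun j => isHomogeneous_linPoly _)
      fun i => ?_
    · rw [hI] at hf ⊢
      exact fun v hv => eval_homogeneousComponent_eq_zero (fun c _ => hf _ (smul_mem_cone hv c)) d
    · rw [← vanishingIdeal_zeroLocus_eq_radical (K := k), mem_vanishingIdeal_iff]
      intro v hv
      rw [mem_zeroLocus_iff] at hv
      have hvH : v ∈ cone H := mem_cone_of_isClosed hHi.nonempty hHc v fun f hf => by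
        simpa [aeval_eq_eval] using hv f (Ideal.mem_sup_left ((hI f).2 hf))
      have : v = 0 := hg v hvH fun j => by
        simpa [aeval_eq_eval, eval_linPoly] using
          hv _ (Ideal.mem_sup_right (Ideal.subset_span ⟨j, rfl⟩))
      simp [this]
  have htr := Algebra.IsAlgebraic.trdeg_le_cardinalMk k
    (Set.range fun j => Ideal.Quotient.mk I (linPoly (g j)))
  have hind : AlgebraicIndependent k fun j => Ideal.Quotient.mk I (linPoly (y j)) := by
    rw [algebraicIndependent_iff]
    intro P hP
    have h : aeval (fun j => linPoly (y j)) P ∈ I := by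
      rw [← Ideal.Quotient.eq_zero_iff_mem, ← hP, ← Ideal.Quotient.mkₐ_eq_mk k,
        ← AlgHom.comp_apply, comp_aeval]
    refine hy P fun v hv => ?_
    simpa only [eval_aeval_apply, eval_linPoly] using (hI _).1 h v hv
  have h1 := hind.cardinalMk_le_trdeg.trans (htr.trans Cardinal.mk_range_le)
  simpa using h1

end Independence

section Join

variable {k : Type} [Field k] {n : ℕ}

/-- The pairs `(p, o)` of vectors in the cone over `Y` and in its span for which `o` is a multiple
of `p` plus a sum of `t` elements of the cone are Zariski dense among all such pairs. -/
def JoinDense (Y : Set (PS k n)) (t : ℕ) : Prop :=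
  ∀ F : MvPolynomial (Fin n ⊕ Fin n) k,
    (∀ p ∈ cone Y, ∀ c : k, ∀ b ∈ sumSet (cone Y) t, eval (Sum.elim p (c • p + b)) F = 0) →
    ∀ p ∈ cone Y, ∀ o ∈ pspan Y, eval (Sum.elim p o) F = 0

/-- The polynomial in the second variable obtained by fixing the first. -/
def fixLeft (F : MvPolynomial (Fin n ⊕ Fin n) k) (p : Fin n → k) : MvPolynomial (Fin n) k :=
  aeval (Sum.elim (fun i => C (p i)) X) F

/-- The polynomial in the first variable obtained by fixing the second. -/
def fixRight (F : MvPolynomial (Fin n ⊕ Fin n) k) (o : Fin n → k) : MvPolynomial (Fin n) k :=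
  aeval (Sum.elim X fun i => C (o i)) F

theorem eval_fixLeft (F : MvPolynomial (Fin n ⊕ Fin n) k) (p o : Fin n → k) :
    eval o (fixLeft F p) = eval (Sum.elim p o) F := by
  rw [fixLeft, eval_aeval_apply]
  congr 2
  ext (i | i) <;> simp

theorem eval_fixRight (F : MvPolynomial (Fin n ⊕ Fin n) k) (p o : Fin n → k) :
    eval p (fixRight F o) = eval (Sum.elim p o) F := by
  rw [fixRight, eval_aeval_apply]
  congr 2
  ext (i | i) <;> simp

theorem JoinDense.exists_polynomial [IsAlgClosed k] {Y : Set (PS k n)} (hYc : IsClosed Y)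
    (hYi : IsIrreducible Y) {t : ℕ} (hE : JoinDense Y t) :
    ∃ F : MvPolynomial (Fin n ⊕ Fin n) k,
      (∃ p ∈ cone Y, ∃ o ∈ pspan Y, eval (Sum.elim p o) F ≠ 0) ∧
      ∀ p ∈ cone Y, ∀ o ∈ pspan Y, eval (Sum.elim p o) F ≠ 0 →
        ∃ c : k, ∃ b ∈ sumSet (cone Y) t, o = c • p + b := by
  have : Infinite k := IsAlgClosed.instInfinite
  have hC : ZIrr (cone Y) := ZIrr.of_isIrreducible hYi
  have hZ := (ZIrr.univ (k := k) (σ := Unit)).prod (hC.prod (hC.pow t))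
  set Z := {c : Unit ⊕ (Fin n ⊕ (Fin t × Fin n)) → k | c ∘ Sum.inl ∈ Set.univ ∧ c ∘ Sum.inr ∈
    {c : Fin n ⊕ (Fin t × Fin n) → k | c ∘ Sum.inl ∈ cone Y ∧ c ∘ Sum.inr ∈ powSet (cone Y) t}}
  let φ : (Unit ⊕ (Fin n ⊕ (Fin t × Fin n)) → k) → (Fin n ⊕ Fin n) → k := fun a =>
    Sum.elim (fun j => a (.inr (.inl j)))
      (fun j => a (.inl ()) * a (.inr (.inl j)) + ∑ i, a (.inr (.inr (i, j))))
  have hφZ : ∀ p ∈ cone Y, ∀ c : k, ∀ b ∈ sumSet (cone Y) t, ∃ a ∈ Z,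
      φ a = Sum.elim p (c • p + b) := by
    rintro p hp c _ ⟨a, ha, rfl⟩
    refine ⟨Sum.elim (fun _ => c) (Sum.elim p fun x => a x.1 x.2), ⟨trivial, hp, ha⟩, ?_⟩
    ext (j | j) <;> simp [φ]
  have hZφ : ∀ a ∈ Z, ∃ p ∈ cone Y, ∃ c : k, ∃ b ∈ sumSet (cone Y) t,
      φ a = Sum.elim p (c • p + b) := by
    rintro a ⟨-, hp, ha⟩
    refine ⟨_, hp, a (.inl ()), _, ⟨fun i j => a (.inr (.inr (i, j))), ha, rfl⟩, ?_⟩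
    ext (j | j) <;> simp [φ]
  have hZc : ∀ v, (∀ f, (∀ a ∈ Z, eval a f = 0) → eval v f = 0) → v ∈ Z := by
    refine fun v hv => ⟨trivial, mem_cone_of_isClosed hYi.nonempty hYc _ fun f hf => ?_, fun i =>
      mem_cone_of_isClosed hYi.nonempty hYc _ fun f hf => ?_⟩
    · exact (eval_rename (Sum.inr ∘ Sum.inl) v f).symm.trans
        (hv _ fun a ha => (eval_rename _ _ _).trans (hf _ ha.2.1))
    · exact (eval_rename (fun j => Sum.inr (Sum.inr (i, j))) v f).symm.trans
        (hv _ fun a ha => (eval_rename _ _ _).trans (hf _ (ha.2.2 i)))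
  have hφ : ∀ j, IsPolyFun fun a => φ a j := by
    rintro (j | j)
    · exact .coord _
    · exact .add (.mul (.coord _) (.coord _)) (.sum _ fun i => .coord _)
  obtain ⟨F, ⟨z, hz, hFz⟩, hF⟩ := exists_open_subset_image hZ hZc hφ
  refine ⟨F, ?_, fun p hp o ho hpo => ?_⟩
  · obtain ⟨p, hp, c, b, hb, h⟩ := hZφ z hz
    exact ⟨p, hp, c • p + b, (pspan Y).add_mem ((pspan Y).smul_mem _ (cone_subset_pspan _ hp))
      (sumSet_subset_pspan _ _ hb), h ▸ hFz⟩
  · obtain ⟨a, ha, h⟩ := hF _ (fun f hf => hE f (fun p hp c b hb => by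
      obtain ⟨a, ha, h⟩ := hφZ p hp c b hb
      exact h ▸ hf a ha) p hp o ho) hpo
    obtain ⟨p', hp', c, b, hb, h'⟩ := hZφ a ha
    rw [h'] at h
    have h1 : p' = p := congrArg (· ∘ Sum.inl) h
    have h2 : c • p' + b = o := congrArg (· ∘ Sum.inr) h
    exact ⟨c, b, hb, by rw [← h2, h1]⟩

end Join

section JoinDimension

variable {k : Type} [Field k] {n : ℕ}

theorem exists_set_cone_eq {D : Set (Fin n → k)} (h0 : 0 ∈ D)
    (hD : ∀ v ∈ D, ∀ c : k, c • v ∈ D) : ∃ S : Set (PS k n), cone S = D := by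
  refine ⟨{q | q.rep ∈ D}, ?_⟩
  ext v
  rcases eq_or_ne v 0 with rfl | hv
  · exact iff_of_true (zero_mem_cone _) h0
  · rw [mem_cone_mk hv]
    obtain ⟨a, ha⟩ := Projectivization.exists_smul_eq_mk_rep k v hv
    rw [Set.mem_ofPred_eq, ← ha]
    refine ⟨fun h => ?_, fun h => hD v h a⟩
    have := hD _ h (a⁻¹ : kˣ)
    rwa [← Units.smul_def, inv_smul_smul] at this

theorem joinDense_of_pdim [Infinite k] {Y : Set (PS k n)} (hY : Y.Infinite)
    (hYi : IsIrreducible Y) {t d : ℕ} (ht : 1 ≤ t)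
    (hL : pdim (linSet (pspan Y)) = (d + 1 : ℕ)) (hH : pdim (secant Y t) = d) :
    JoinDense Y t := by
  have hC : ZIrr (cone Y) := ZIrr.of_isIrreducible hYi
  have key : ∀ p ∈ cone Y,
      (∀ f : MvPolynomial (Fin n) k,
        (∀ c : k, ∀ b ∈ sumSet (cone Y) t, eval (c • p + b) f = 0) →
        ∀ o ∈ pspan Y, eval o f = 0) ∨
      ∀ c : k, ∀ b ∈ sumSet (cone Y) t, c • p + b ∈ cone (secant Y t) := by
    intro p hp
    have hK : ZIrr {v | ∃ c : k, ∃ b ∈ sumSet (cone Y) t, v = c • p + b} := by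
      convert ((ZIrr.univ (k := k) (σ := Unit)).prod (hC.sumSet t)).image
        (φ := fun a j => a (.inl ()) * p j + a (.inr j))
        fun j => .add (.mul (.coord _) (.const _)) (.coord _)
      ext v
      constructor
      · rintro ⟨c, b, hb, rfl⟩
        exact ⟨Sum.elim (fun _ => c) b, ⟨trivial, hb⟩, rfl⟩
      · rintro ⟨a, ⟨-, ha⟩, rfl⟩
        exact ⟨a (.inl ()), a ∘ Sum.inr, ha, rfl⟩
    obtain ⟨S, hS⟩ := exists_set_cone_eq
      (D := {v | ∃ c : k, ∃ b ∈ sumSet (cone Y) t, v = c • p + b})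
      ⟨0, 0, zero_mem_sumSet (zero_mem_cone _) t, by simp⟩ (by
        rintro _ ⟨c, b, hb, rfl⟩ a
        exact ⟨a * c, a • b, smul_mem_sumSet hb a, by rw [smul_add, smul_smul]⟩)
    have hdS : {q | hasDecomp Y q t} ⊆ S := subset_of_cone_subset <| by
      rw [cone_hasDecomp hY, hS]
      exact fun b hb => ⟨0, b, hb, by simp⟩
    have hSne : S.Nonempty := by
      obtain ⟨x, hx⟩ := hYi.nonempty
      exact ⟨x, hdS (subset_setOf_hasDecomp hY ht hx)⟩
    have hSL : closure S ⊆ linSet (pspan Y) := by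
      refine closure_minimal (subset_of_cone_subset ?_) (isClosed_linSet _)
      rw [hS, cone_linSet]
      rintro _ ⟨c, b, hb, rfl⟩
      exact (pspan Y).add_mem ((pspan Y).smul_mem _ (cone_subset_pspan _ hp))
        (sumSet_subset_pspan _ _ hb)
    have hSi : IsIrreducible (closure S) :=
      (ZIrr.isIrreducible hSne (hS ▸ hK)).closure
    have hHS : secant Y t ⊆ closure S := closure_mono hdS
    by_cases hgood : closure S = linSet (pspan Y)
    · left
      intro f hf o ho
      have : o ∈ cone (closure S) := by rwa [hgood, cone_linSet]
      refine (mem_cone_closure hSne).1 this f ?_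
      rw [hS]
      rintro _ ⟨c, b, hb, rfl⟩
      exact hf c b hb
    · right
      have hlt := pdim_lt_of_ssubset isClosed_closure (isIrreducible_linSet_pspan hYi.nonempty)
        (Set.ssubset_iff_subset_ne.2 ⟨hSL, hgood⟩) hL
      have heq : secant Y t = closure S := by
        by_contra hne
        have := topologicalKrullDim_lt_of_ssubset isClosed_closure hSi
          (Set.ssubset_iff_subset_ne.2 ⟨hHS, hne⟩) hlt
        exact this.ne hH
      intro c b hb
      rw [heq]
      refine cone_mono subset_closure ?_
      rw [hS]
      exact ⟨c, b, hb, rfl⟩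
  have hex : ∃ p ∈ cone Y, ∃ c : k, ∃ b ∈ sumSet (cone Y) t, c • p + b ∉ cone (secant Y t) := by
    by_contra! hall
    have hadd : ∀ p ∈ cone Y, ∀ h ∈ cone (secant Y t), p + h ∈ cone (secant Y t) := by
      intro p hp h hh
      rw [mem_cone_secant hY ht]
      intro f hf
      obtain ⟨g, hg⟩ : IsPolyFun fun w : Fin n → k => eval (p + w) f :=
        .comp (φ := fun w j => p j + w j) (fun j => .add (.const _) (.coord _)) (.eval f)
      replace hg : ∀ w, eval (p + w) f = eval w g := hg
      rw [hg]
      refine (mem_cone_secant hY ht).1 hh g fun b hb => ?_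
      rw [← hg]
      have := hall p hp 1 b hb
      rw [one_smul] at this
      exact (mem_cone_secant hY ht).1 this f hf
    have hsum : ∀ m, sumSet (cone Y) m ⊆ cone (secant Y t) := by
      intro m
      induction m with
      | zero =>
        intro v hv
        rw [mem_sumSet_zero.1 hv]
        exact zero_mem_cone _
      | succ m ih =>
        intro v hv
        obtain ⟨a, ha, b, hb, rfl⟩ := mem_sumSet_succ.1 hv
        exact hadd a ha b (ih hb)
    have hsub : linSet (pspan Y) ⊆ secant Y t := by
      rw [← secant_eq_linSet hY le_rfl]
      refine closure_minimal (subset_of_cone_subset ?_) isClosed_closure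
      rw [cone_hasDecomp hY]
      exact hsum _
    have := pdim_mono hsub
    rw [hL, hH] at this
    exact absurd this (not_le.2 (by exact_mod_cast Nat.lt_succ_self d))
  obtain ⟨p₁, hp₁, c, b, hb, hout⟩ := hex
  rw [mem_cone_secant hY ht] at hout
  push Not at hout
  obtain ⟨f, hf, hfne⟩ := hout
  intro F hF p hp o ho
  have hprod : ∀ p ∈ cone Y, eval (c • p + b) f * eval p (fixRight F o) = 0 := by
    intro p hp
    by_cases hfp : eval (c • p + b) f = 0
    · rw [hfp, zero_mul]
    · rcases key p hp with h | h
      · rw [eval_fixRight, ← eval_fixLeft, h _ (fun c' b' hb' => ?_) o ho, mul_zero]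
        rw [eval_fixLeft]
        exact hF p hp c' b' hb'
      · exact absurd ((mem_cone_secant hY ht).1 (h c b hb) f hf) hfp
  rcases hC.dich _ _ (.comp (φ := fun p j => c * p j + b j)
    (fun j => .add (.mul (.const _) (.coord _)) (.const _)) (.eval f))
    (.eval (fixRight F o)) hprod with h | h
  · exact absurd (h p₁ hp₁) hfne
  · rw [← eval_fixRight]
    exact h p hp

theorem exists_linear_map_of_mem {L : Submodule k (Fin n → k)} (p : Fin n → k) :
    ∃ l : ℕ, Module.finrank k L ≤ l + 1 ∧ ∃ y : (Fin n → k) →ₗ[k] (Fin l → k),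
      y p = 0 ∧ ∀ a, ∃ v ∈ L, y v = a := by
  let π := (Submodule.span k {p}).mkQ
  let e := Module.finBasis k (L.map π) |>.equivFun
  obtain ⟨g, hg⟩ := LinearMap.exists_extend e.toLinearMap
  refine ⟨Module.finrank k (L.map π), ?_, g ∘ₗ π, ?_, fun a => ?_⟩
  · have h1 := (π.domRestrict L).finrank_range_add_finrank_ker
    rw [LinearMap.range_domRestrict] at h1
    have h2 : Module.finrank k (LinearMap.ker (π.domRestrict L)) ≤ 1 := by
      rw [LinearMap.ker_domRestrict, Submodule.ker_mkQ]
      rw [← Submodule.finrank_map_subtype_eq]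
      refine (Submodule.finrank_mono (Submodule.map_comap_le _ _)).trans ?_
      exact (finrank_span_le_card _).trans (by simp)
    omega
  · have : π p = 0 := by simp [π]
    rw [LinearMap.comp_apply, this, map_zero]
  · obtain ⟨v, hv, hva⟩ := (e.symm a).2
    refine ⟨v, hv, ?_⟩
    have := LinearMap.congr_fun hg (e.symm a)
    simp only [LinearMap.comp_apply, Submodule.subtype_apply] at this
    rw [LinearMap.comp_apply, hva, this]
    simp

theorem JoinDense.finrank_pspan_le [IsAlgClosed k] {Y : Set (PS k n)} (hY : Y.Infinite)
    (hYc : IsClosed Y) (hYi : IsIrreducible Y) {t m : ℕ} (ht : 1 ≤ t) (hE : JoinDense Y t)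
    (hH : pdim (secant Y t) < m) : Module.finrank k (pspan Y) ≤ m + 1 := by
  have : Infinite k := IsAlgClosed.instInfinite
  obtain ⟨F, ⟨p, hp, o, ho, hpo⟩, hF⟩ := hE.exists_polynomial hYc hYi
  obtain ⟨l, hl, y, hyp, hy⟩ := exists_linear_map_of_mem (L := pspan Y) p
  have hHi := isIrreducible_secant hY hYi ht
  obtain ⟨g, hg⟩ := exists_linear_forms_of_finite m {secant Y t} (Set.finite_singleton _)
    (by simp [secant]) (by simpa using hHi) (by simpa using hH)
  have := le_of_linear_forms isClosed_closure hHi g (hg _ rfl)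
    (fun j => LinearMap.proj j ∘ₗ y) fun P hP => ?_
  · omega
  have hprod : ∀ o ∈ pspan Y, eval (y o) P * eval o (fixLeft F p) = 0 := by
    intro o ho
    by_cases hne : eval (Sum.elim p o) F = 0
    · rw [eval_fixLeft, hne, mul_zero]
    · obtain ⟨c, b, hb, rfl⟩ := hF p hp o ho hne
      have : eval (y b) P = 0 := hP b (cone_mono subset_closure (by rwa [cone_hasDecomp hY]))
      rw [map_add, map_smul, hyp, smul_zero, zero_add, this, zero_mul]
  rcases (ZIrr.submodule (pspan Y)).dich _ _ (.comp (φ := fun o j => y o j)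
    (fun j => .linear (LinearMap.proj j ∘ₗ y)) (.eval P)) (.eval _) hprod with h | h
  · refine MvPolynomial.funext fun a => ?_
    obtain ⟨v, hv, rfl⟩ := hy a
    exact (h v hv).trans (map_zero _).symm
  · exact absurd (h o ho) (by rwa [eval_fixLeft])

end JoinDimension

section Decompositions

variable {k : Type} [Field k] {n : ℕ}

theorem rk_eq {X : Set (PS k n)} {q : PS k n} {s : ℕ} (hq : hasDecomp X q s)
    (hlt : ∀ t < s, ¬ hasDecomp X q t) : rk X q = s :=
  le_antisymm (Nat.sInf_le hq) (not_lt.1 fun h => hlt _ h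
    (Nat.sInf_mem (s := {s | hasDecomp X q s}) ⟨s, hq⟩))

theorem mem_decomps_iff {X : Set (PS k n)} {q : PS k n} {s : ℕ} (hq : hasDecomp X q s)
    (hlt : ∀ t < s, ¬ hasDecomp X q t) {A : Finset (PS k n)} :
    A ∈ decomps X q ↔ ↑A ⊆ X ∧ A.card = s ∧ memSpan q (A : Set (PS k n)) := by
  rw [decomps, Set.mem_ofPred_eq, rk_eq hq hlt]
  refine ⟨fun ⟨h1, h2, h3, _⟩ => ⟨h1, h2, h3⟩, fun ⟨h1, h2, h3⟩ => ⟨h1, h2, h3, ?_⟩⟩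
  intro B hB hqB
  exact hlt B.card (h2 ▸ Finset.card_lt_card hB)
    ⟨B, (Finset.coe_subset.2 hB.1).trans h1, rfl, hqB⟩

theorem subset_entryLocus {X : Set (PS k n)} {q : PS k n} {A : Finset (PS k n)}
    (hA : A ∈ decomps X q) : (A : Set (PS k n)) ⊆ entryLocus X q :=
  (Set.subset_biUnion_of_mem (u := fun A : Finset (PS k n) => (A : Set (PS k n))) hA).trans
    subset_closure

theorem entryLocus_subset {X : Set (PS k n)} (hX : IsClosed X) (q : PS k n) :
    entryLocus X q ⊆ X :=
  closure_minimal (Set.iUnion₂_subset fun _ hA => hA.1) hX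

theorem memSpan_singleton {p q : PS k n} : memSpan q {p} ↔ q = p := by
  rw [memSpan, pspan, iSup_singleton]
  refine ⟨fun h => ?_, fun h => h ▸ le_rfl⟩
  refine Projectivization.submodule_injective ?_
  refine Submodule.eq_of_le_of_finrank_eq h ?_
  rw [Projectivization.finrank_submodule, Projectivization.finrank_submodule]

theorem not_hasDecomp_zero (X : Set (PS k n)) (q : PS k n) : ¬ hasDecomp X q 0 := by
  rintro ⟨A, -, hA, hq⟩
  rw [Finset.card_eq_zero] at hA
  subst hA
  rw [memSpan, pspan, Finset.coe_empty, iSup_emptyset, le_bot_iff] at hq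
  have := q.finrank_submodule
  rw [hq, finrank_bot] at this
  exact absurd this zero_ne_one

theorem exists_finset_mk_mem {Y : Set (PS k n)} (hY : Y.Infinite) {t : ℕ} (ht : 1 ≤ t)
    {p b v : Fin n → k} (hp : p ∈ cone Y) (hp0 : p ≠ 0) (hb : b ∈ sumSet (cone Y) t) {c : k}
    (hv : v = c • p + b) (hv0 : v ≠ 0) (hvt : ¬ hasDecomp Y (Projectivization.mk k v hv0) t) :
    ∃ A : Finset (PS k n), ↑A ⊆ Y ∧ A.card = t + 1 ∧ Projectivization.mk k p hp0 ∈ A ∧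
      memSpan (Projectivization.mk k v hv0) (A : Set (PS k n)) := by
  classical
  have hb0 : b ≠ 0 := by
    rintro rfl
    rw [add_zero] at hv
    refine hvt (subset_setOf_hasDecomp hY ht ?_)
    rw [← mem_cone_mk hv0, hv]
    exact smul_mem_cone hp c
  obtain ⟨B, hBY, hBt, hbB⟩ := (hasDecomp_mk hY hb0).2 hb
  rw [memSpan_mk] at hbB
  have hpA : p ∈ pspan (insert (Projectivization.mk k p hp0) (B : Set (PS k n))) :=
    cone_subset_pspan _ fun _ => Set.mem_insert _ _
  have hvA : v ∈ pspan (insert (Projectivization.mk k p hp0) (B : Set (PS k n))) := by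
    rw [hv]
    exact Submodule.add_mem _ (Submodule.smul_mem _ _ hpA) (pspan_mono (Set.subset_insert _ _) hbB)
  have hpB : Projectivization.mk k p hp0 ∉ B := by
    intro hpB
    refine hvt ⟨B, hBY, hBt, (memSpan_mk hv0).2 ?_⟩
    rwa [Set.insert_eq_of_mem (Finset.mem_coe.2 hpB)] at hvA
  refine ⟨insert (Projectivization.mk k p hp0) B, ?_, ?_, Finset.mem_insert_self _ _, ?_⟩
  · rw [Finset.coe_insert]
    exact Set.insert_subset (hp hp0) hBY
  · rw [Finset.card_insert_of_notMem hpB, hBt]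
  · rwa [Finset.coe_insert, memSpan_mk]

theorem exists_eq_smul_add_of_mem_pspan {Y : Set (PS k n)} {A : Finset (PS k n)} (hA : ↑A ⊆ Y)
    {t : ℕ} (hAt : A.card = t + 1) {p v : Fin n → k} (hp0 : p ≠ 0)
    (hp : Projectivization.mk k p hp0 ∈ A) (hv : v ∈ pspan (A : Set (PS k n))) :
    ∃ c : k, ∃ b ∈ sumSet (cone Y) t, v = c • p + b := by
  classical
  rw [← Finset.insert_erase hp, Finset.coe_insert, mem_pspan_insert] at hv
  obtain ⟨c, b, hb, rfl⟩ := hv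
  obtain ⟨a, ha⟩ := Projectivization.exists_smul_eq_mk_rep k p hp0
  have := mem_sumSet_of_mem_pspan (X := Y) _
    ((Finset.coe_subset.2 (Finset.erase_subset _ _)).trans hA) hb
  rw [Finset.card_erase_of_mem hp, hAt, Nat.add_sub_cancel] at this
  exact ⟨c * a, b, this, by rw [← ha, mul_smul, Units.smul_def]⟩

theorem isIrreducible_univ_of_pos [Infinite k] (hn : 0 < n) :
    IsIrreducible (Set.univ : Set (PS k n)) := by
  have : Nonempty (Fin n) := ⟨⟨0, hn⟩⟩
  have h : linSet (⊤ : Submodule k (Fin n → k)) = Set.univ :=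
    Set.eq_univ_of_forall fun p => (le_top : p.submodule ≤ ⊤)
  exact h ▸ isIrreducible_linSet (h ▸ Set.univ_nonempty)

theorem generic_hasDecomp [IsAlgClosed k] (hn : 0 < n) {X : Set (PS k n)} (hX : X.Infinite)
    (hXc : IsClosed X) (hXi : IsIrreducible X) {s : ℕ} (hs : 1 ≤ s)
    (hsec : secant X s = Set.univ) : Generic fun q => hasDecomp X q s := by
  have : Infinite k := IsAlgClosed.instInfinite
  have hC : ZIrr (cone X) := ZIrr.of_isIrreducible hXi
  have hZc : ∀ v, (∀ f, (∀ a ∈ powSet (cone X) s, eval a f = 0) → eval v f = 0) →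
      v ∈ powSet (cone X) s := fun v hv i =>
    mem_cone_of_isClosed hXi.nonempty hXc _ fun f hf =>
      (eval_rename (fun j => (i, j)) v f).symm.trans
        (hv _ fun a ha => (eval_rename _ _ _).trans (hf _ (ha i)))
  have hφ : ∀ j : Fin n, IsPolyFun fun a : Fin s × Fin n → k => ∑ i, a (i, j) :=
    fun j => .sum _ fun i => .coord _
  obtain ⟨F, ⟨y, hy, hFy⟩, hF⟩ := exists_open_subset_image (hC.pow s) hZc hφ
  have hmem : ∀ v, eval v F ≠ 0 → v ∈ sumSet (cone X) s := by
    intro v hv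
    have hvF : ∀ f, (∀ a ∈ powSet (cone X) s, eval (fun j => ∑ i, a (i, j)) f = 0) →
        eval v f = 0 := by
      intro f hf
      refine (mem_cone_secant hX hs).1 (fun _ => by rw [hsec]; trivial) f ?_
      rintro _ ⟨a, ha, rfl⟩
      convert hf (fun x => a x.1 x.2) ha
      simp
    obtain ⟨a, ha, rfl⟩ := hF v hvF hv
    exact ⟨fun i j => a (i, j), ha, by ext; simp⟩
  have huniv := isIrreducible_univ_of_pos (k := k) hn
  obtain ⟨v, hv0, hv⟩ : ∃ v, v ≠ 0 ∧ eval v F ≠ 0 := by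
    by_contra! h
    exact hFy (eval_eq_zero_of_mem_cone huniv.nonempty (fun v _ h0 => h v h0) _ fun _ => trivial)
  obtain ⟨W, hW, hvW, hWF⟩ := exists_isOpen_smul_eval_ne_zero hv0 hv
  have : PreirreducibleSpace (PS k n) := ⟨huniv.2⟩
  refine ⟨W, hW, hW.dense ⟨_, hvW⟩, fun q hq => ?_⟩
  induction q using Projectivization.ind with
  | h w hw =>
    obtain ⟨c, hc, hcw⟩ := hWF w hw hq
    rw [hasDecomp_mk hX]
    have := smul_mem_sumSet (hmem _ hcw) c⁻¹
    rwa [inv_smul_smul₀ hc] at this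

theorem generic_notMem_of_isClosed [Infinite k] (hn : 0 < n) {Z : Set (PS k n)} (hZ : IsClosed Z)
    (hne : Z ≠ Set.univ) : Generic fun q => q ∉ Z := by
  have : PreirreducibleSpace (PS k n) := ⟨(isIrreducible_univ_of_pos hn).2⟩
  exact ⟨Zᶜ, hZ.isOpen_compl, hZ.isOpen_compl.dense (Set.nonempty_compl.2 hne), fun _ h => h⟩

theorem Generic.and {P Q : PS k n → Prop} (hP : Generic P) (hQ : Generic Q) :
    Generic fun q => P q ∧ Q q := by
  obtain ⟨U, hU, hUd, hUP⟩ := hP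
  obtain ⟨V, hV, hVd, hVQ⟩ := hQ
  exact ⟨U ∩ V, hU.inter hV, hUd.inter_of_isOpen_left hVd hU, fun q hq => ⟨hUP q hq.1, hVQ q hq.2⟩⟩

end Decompositions

section EntryLocus

variable {k : Type} [Field k] {n : ℕ}

theorem pdim_linSet_pspan [Infinite k] {Y : Set (PS k n)} (hY : Y.Infinite) {γ : ℕ}
    (hN : NonDefective Y γ) : pdim (linSet (pspan Y)) = (spanDim Y : ℕ) := by
  rw [← secant_eq_linSet hY (Nat.le_succ _), hN _ (Nat.succ_pos _)]
  congr 1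
  rw [spanDim]
  refine min_eq_right (Nat.sub_le_sub_right ?_ 1)
  exact (Nat.le_succ _).trans (Nat.le_mul_of_pos_left _ (Nat.succ_pos _))

theorem pdim_secant_of_ne [Infinite k] {Y : Set (PS k n)} (hY : Y.Infinite)
    {γ : ℕ} (hN : NonDefective Y γ) {t : ℕ} (ht : 1 ≤ t) (hne : secant Y t ≠ linSet (pspan Y)) :
    pdim (secant Y t) = ((γ + 1) * t - 1 : ℕ) ∧ (γ + 1) * t - 1 < spanDim Y := by
  have hlt := pdim_lt_of_ssubset isClosed_closure (isIrreducible_linSet_pspan hY.nonempty)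
    (Set.ssubset_iff_subset_ne.2 ⟨secant_subset_linSet Y t, hne⟩) (pdim_linSet_pspan hY hN)
  change pdim (secant Y t) < _ at hlt
  rw [hN t ht] at hlt ⊢
  have h : min ((γ + 1) * t - 1) (spanDim Y) < spanDim Y := by exact_mod_cast hlt
  have h' : (γ + 1) * t - 1 < spanDim Y := by omega
  exact ⟨by rw [min_eq_left h'.le], h'⟩

theorem joinDense_of_entryLocus_eq [Infinite k] {X Y : Set (PS k n)} (hY : Y.Nonempty) {t : ℕ}
    {O : Set (PS k n)} (hO : O.Nonempty) (hOd : linSet (pspan Y) ⊆ closure O)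
    (hOY : ∀ o ∈ O, entryLocus X o = Y ∧ rk X o = t + 1) : JoinDense Y t := by
  intro F hF
  have hfix : ∀ o ∈ cone O, o ≠ 0 → ∀ p ∈ cone Y, eval (Sum.elim p o) F = 0 := by
    intro o ho ho0 p hp
    obtain ⟨hoY, hrk⟩ := hOY _ (ho ho0)
    have hne : (⋃ A ∈ decomps X (Projectivization.mk k o ho0), (A : Set (PS k n))).Nonempty := by
      rw [← closure_nonempty_iff]
      exact hY.mono hoY.ge
    rw [← hoY, entryLocus, mem_cone_closure hne] at hp
    rw [← eval_fixRight]
    refine hp _ (eval_eq_zero_of_mem_cone hne fun w hw hw0 => ?_)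
    obtain ⟨A, hA, hwA⟩ := Set.mem_iUnion₂.1 (hw hw0)
    obtain ⟨c, b, hb, rfl⟩ := exists_eq_smul_add_of_mem_pspan (Y := Y)
      ((subset_entryLocus hA).trans hoY.le) (hA.2.1.trans hrk) hw0 hwA
      ((memSpan_mk ho0).1 hA.2.2.1)
    rw [eval_fixRight]
    exact hF w (fun h => hoY ▸ subset_entryLocus hA hwA) c b hb
  intro p hp o ho
  rw [← eval_fixLeft]
  have : o ∈ cone (closure O) := cone_mono hOd (by rwa [cone_linSet])
  refine (mem_cone_closure hO).1 this _ (eval_eq_zero_of_mem_cone hO fun o ho ho0 => ?_)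
  rw [eval_fixLeft]
  exact hfix o ho ho0 p hp

theorem subset_entryLocus_of_eval_ne_zero [Infinite k] {X Y : Set (PS k n)} (hYX : Y ⊆ X)
    (hY : Y.Infinite) (hYi : IsIrreducible Y) {t : ℕ} (ht : 1 ≤ t)
    {F : MvPolynomial (Fin n ⊕ Fin n) k}
    (hF : ∀ p ∈ cone Y, ∀ o ∈ pspan Y, eval (Sum.elim p o) F ≠ 0 →
      ∃ c : k, ∃ b ∈ sumSet (cone Y) t, o = c • p + b)
    {v : Fin n → k} (hv0 : v ≠ 0) (hv : v ∈ pspan Y)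
    (hvF : ∃ p ∈ cone Y, eval (Sum.elim p v) F ≠ 0)
    (hdec : hasDecomp X (Projectivization.mk k v hv0) (t + 1))
    (hlt : ∀ i < t + 1, ¬ hasDecomp X (Projectivization.mk k v hv0) i) :
    Y ⊆ entryLocus X (Projectivization.mk k v hv0) := by
  have hne : (entryLocus X (Projectivization.mk k v hv0)).Nonempty := by
    obtain ⟨A, hA⟩ := hdec
    obtain ⟨a, ha⟩ := Finset.card_pos.1 (hA.2.1.symm ▸ t.succ_pos : 0 < A.card)
    exact ⟨a, subset_entryLocus ((mem_decomps_iff ⟨A, hA⟩ hlt).2 hA) ha⟩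
  apply subset_of_cone_subset
  intro p hp
  refine mem_cone_of_isClosed hne isClosed_closure p fun f hf => ?_
  obtain ⟨p₁, hp₁, hne₁⟩ := hvF
  have hprod : ∀ p ∈ cone Y, eval p f * eval p (fixRight F v) = 0 := by
    intro p hp
    rcases eq_or_ne p 0 with rfl | hp0
    · rw [hf 0 (zero_mem_cone _), zero_mul]
    by_cases hpF : eval (Sum.elim p v) F = 0
    · rw [eval_fixRight, hpF, mul_zero]
    obtain ⟨c, b, hb, hvb⟩ := hF p hp v hv hpF
    obtain ⟨A, hAY, hAt, hpA, hvA⟩ := exists_finset_mk_mem hY ht hp hp0 hb hvb hv0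
      fun h => hlt t (Nat.lt_succ_self t) (hasDecomp_mono_left hYX h)
    rw [hf p fun _ => subset_entryLocus
      ((mem_decomps_iff hdec hlt).2 ⟨hAY.trans hYX, hAt, hvA⟩) hpA, zero_mul]
  rcases (ZIrr.of_isIrreducible hYi).dich _ _ (.eval f) (.eval _) hprod with h | h
  · exact h p hp
  · exact absurd (h p₁ hp₁) (by rwa [eval_fixRight])

theorem infinite_entryLocus [Infinite k] {X : Set (PS k n)} {q : PS k n} {s : ℕ} (hs : 2 ≤ s)
    (hi : IsIrreducible (entryLocus X q)) (hdec : hasDecomp X q s)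
    (hlt : ∀ i < s, ¬ hasDecomp X q i) : (entryLocus X q).Infinite := by
  obtain ⟨A, hA⟩ := hdec
  obtain ⟨a, ha, b, hb, hab⟩ := Finset.one_lt_card.1 (hA.2.1.symm ▸ hs)
  have h := subset_entryLocus ((mem_decomps_iff ⟨A, hA⟩ hlt).2 hA)
  exact infinite_of_isIrreducible hi (h ha) (h hb) hab

theorem mem_linSet_pspan_entryLocus {X : Set (PS k n)} {q : PS k n} {s : ℕ}
    (hdec : hasDecomp X q s) (hlt : ∀ i < s, ¬ hasDecomp X q i) :
    q ∈ linSet (pspan (entryLocus X q)) := by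
  obtain ⟨A, hA⟩ := hdec
  exact hA.2.2.trans (pspan_mono (subset_entryLocus ((mem_decomps_iff ⟨A, hA⟩ hlt).2 hA)))

theorem secant_one_eq_linSet [Infinite k] {X : Set (PS k n)} (hXi : IsIrreducible X)
    (hfin : ¬ X.Infinite) : secant X 1 = linSet (pspan X) := by
  obtain ⟨x, hx⟩ := hXi.nonempty
  have hXx : X = {x} := Set.eq_singleton_iff_unique_mem.2 ⟨hx, fun y hy => by
    by_contra hyx
    exact hfin (infinite_of_isIrreducible hXi hy hx hyx)⟩
  refine (secant_subset_linSet X 1).antisymm fun q hq =>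
    subset_closure ⟨{x}, by simp [hx], by simp, ?_⟩
  rw [hXx] at hq
  rw [Finset.coe_singleton]
  exact hq

theorem secant_rgen [Infinite k] {X : Set (PS k n)} (hXi : IsIrreducible X) :
    secant X (rgen X) = linSet (pspan X) := by
  refine Nat.sInf_mem (s := {s | secant X s = linSet (pspan X)}) ?_
  by_cases hX : X.Infinite
  · exact ⟨_, secant_eq_linSet hX le_rfl⟩
  · exact ⟨_, secant_one_eq_linSet hXi hX⟩

theorem infinite_of_two_le_rgen [Infinite k] {X : Set (PS k n)} (hXi : IsIrreducible X)
    (h : 2 ≤ rgen X) : X.Infinite := by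
  by_contra hfin
  have : rgen X ≤ 1 := Nat.sInf_le (secant_one_eq_linSet hXi hfin)
  omega

end EntryLocus

section TypeA

variable {k : Type} [Field k] {n : ℕ}

theorem secant_zero (X : Set (PS k n)) : secant X 0 = ∅ := by
  have : {q | hasDecomp X q 0} = ∅ := Set.eq_empty_of_forall_notMem (not_hasDecomp_zero X)
  rw [secant, this, closure_empty]

theorem secant_one_subset {X : Set (PS k n)} (hX : IsClosed X) : secant X 1 ⊆ X := by
  refine closure_minimal ?_ hX
  rintro q ⟨A, hAX, hA1, hA⟩
  obtain ⟨a, rfl⟩ := Finset.card_eq_one.1 hA1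
  rw [Finset.coe_singleton, memSpan_singleton] at hA
  exact hA ▸ hAX (by simp)

theorem spanDim_singleton (q : PS k n) : spanDim {q} = 0 := by
  rw [spanDim, pspan, iSup_singleton, Projectivization.finrank_submodule]

theorem entryLocus_eq_singleton [Infinite k] {X : Set (PS k n)} {q : PS k n} (hq : q ∈ X) :
    entryLocus X q = {q} := by
  have hdec : hasDecomp X q 1 := ⟨{q}, by simpa, by simp, by simp [memSpan_singleton]⟩
  have hlt : ∀ i < 1, ¬ hasDecomp X q i := fun i hi => by
    rw [Nat.lt_one_iff.1 hi]
    exact not_hasDecomp_zero X q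
  refine (closure_minimal (Set.iUnion₂_subset fun A hA => ?_) isClosed_singleton).antisymm ?_
  · obtain ⟨-, hA1, hA⟩ := (mem_decomps_iff hdec hlt).1 hA
    obtain ⟨a, rfl⟩ := Finset.card_eq_one.1 hA1
    rw [Finset.coe_singleton, memSpan_singleton] at hA
    simp [hA]
  · refine subset_trans ?_ (subset_entryLocus (A := {q})
      ((mem_decomps_iff hdec hlt).2 ⟨by simpa, by simp, by simp [memSpan_singleton]⟩))
    simp

theorem typeA_univ [Infinite k] : TypeA (Set.univ : Set (PS k n)) := by
  refine ⟨Set.univ, isOpen_univ, dense_univ, fun q _ =>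
    ⟨Set.univ, isOpen_univ, by simpa using subset_closure, ?_⟩⟩
  rintro o ⟨ho, -⟩
  rw [entryLocus_eq_singleton (Set.mem_univ q)] at ho
  rw [memSpan_singleton.1 ho]

end TypeA

end EL

open EL in
/-- If `X` is of type I and all secant varieties of the general entry locus
have the expected dimension, then `X` is of type A iff
`ℓ(X) = (γ(X)+1)·r_gen(X) − γ(X) − 1`. -/
theorem statement7 {k : Type} [Field k] [IsAlgClosed k] [CharZero k]
    (r γ ℓ s : ℕ) (X : Set (PS k (r+1))) (hX : IsVariety X) (hnd : Nondeg X)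
    (hs : rgen X = s) (hI : TypeI X)
    (hgen : Generic (fun q : PS k (r+1) =>
      pdim (entryLocus X q) = (γ : WithBot ℕ∞) ∧
      spanDim (entryLocus X q) = ℓ ∧
      NonDefective (entryLocus X q) γ)) :
    (TypeA X ↔ ℓ + γ + 1 = (γ + 1) * s) := by
  have : Infinite k := IsAlgClosed.instInfinite
  obtain ⟨hXc, hXi⟩ := hX
  have huniv := isIrreducible_univ_of_pos (k := k) r.succ_pos
  have : PreirreducibleSpace (PS k (r + 1)) := ⟨huniv.2⟩
  have : Nonempty (PS k (r + 1)) := ⟨huniv.nonempty.some⟩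
  have hlin : linSet (pspan X) = Set.univ := by
    rw [show pspan X = ⊤ from hnd]
    exact Set.eq_univ_of_forall fun p => (le_top : p.submodule ≤ ⊤)
  rcases Nat.lt_or_ge s 2 with hs2 | hs2
  · have hsec := hs ▸ secant_rgen hXi
    rw [hlin] at hsec
    have hs1 : s = 1 := by
      by_contra h1
      obtain rfl : s = 0 := by omega
      rw [secant_zero] at hsec
      exact Set.empty_ne_univ hsec
    subst hs1
    obtain rfl := Set.univ_subset_iff.1 (hsec ▸ secant_one_subset hXc)
    obtain ⟨U, -, hUd, hUP⟩ := hgen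
    obtain ⟨q, hq⟩ := hUd.nonempty
    have hℓ := (hUP q hq).2.1
    rw [entryLocus_eq_singleton (Set.mem_univ q), spanDim_singleton] at hℓ
    exact iff_of_true typeA_univ (by omega)
  obtain ⟨t, rfl⟩ : ∃ t, s = t + 1 := ⟨s - 1, by omega⟩
  have ht : 1 ≤ t := by omega
  have hXinf : X.Infinite := infinite_of_two_le_rgen hXi (hs ▸ hs2)
  have hsec : secant X (t + 1) = Set.univ := by rw [← hs, secant_rgen hXi, hlin]
  have hsec' : secant X t ≠ Set.univ := fun h =>
    Nat.notMem_of_lt_sInf (s := {s | secant X s = linSet (pspan X)})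
      (show t < rgen X by omega) (h.trans hlin.symm)
  have hdec := (generic_hasDecomp r.succ_pos hXinf hXc hXi t.succ_pos hsec).and
    (generic_notMem_of_isClosed r.succ_pos isClosed_closure hsec')
  obtain ⟨U, hU, hUd, hUP⟩ := (hdec.and hI).and hgen
  have hlt : ∀ q ∈ U, ∀ i < t + 1, ¬ hasDecomp X q i := fun q hq i hi h =>
    (hUP q hq).1.1.2 (subset_closure (setOf_hasDecomp_mono hXinf (Nat.lt_succ_iff.1 hi) h))
  have hfacts : ∀ q ∈ U, (entryLocus X q).Infinite ∧ q ∈ linSet (pspan (entryLocus X q)) ∧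
      pdim (secant (entryLocus X q) t) = ((γ + 1) * t - 1 : ℕ) ∧ (γ + 1) * t - 1 < ℓ := by
    intro q hq
    obtain ⟨⟨⟨hq1, hq2⟩, hq3⟩, hq4, hq5, hq6⟩ := hUP q hq
    have hinf := infinite_entryLocus hs2 hq3 hq1 (hlt q hq)
    have hmem := mem_linSet_pspan_entryLocus hq1 (hlt q hq)
    refine ⟨hinf, hmem, hq5 ▸ pdim_secant_of_ne hinf hq6 ht fun h => hq2 ?_⟩
    exact secant_mono_left (entryLocus_subset hXc q) t (h ▸ hmem)
  constructor
  · rintro ⟨V, hV, hVd, hVP⟩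
    obtain ⟨q, hqU, hqV⟩ := (hUd.inter_of_isOpen_left hVd hU).nonempty
    obtain ⟨hinf, hqL, hH, hl⟩ := hfacts q hqU
    obtain ⟨⟨-, hq3⟩, -, hq5, -⟩ := hUP q hqU
    obtain ⟨W, hW, hWd, hWP⟩ := hVP q hqV
    have hL := isIrreducible_linSet_pspan hinf.nonempty
    have hWne : (linSet (pspan (entryLocus X q)) ∩ W).Nonempty :=
      closure_nonempty_iff.1 ⟨q, hWd hqL⟩
    have hne := hL.2 W U hW hU hWne ⟨q, hqL, hqU⟩
    have hJ : JoinDense (entryLocus X q) t := by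
      refine joinDense_of_entryLocus_eq (X := X) hq3.nonempty hne
        (subset_closure_inter_of_isPreirreducible_of_isOpen hL.2 (hW.inter hU) hne) ?_
      rintro o ⟨hoL, hoW, hoU⟩
      exact ⟨hWP o ⟨hoL, hoW⟩, rk_eq (hUP o hoU).1.1.1 (hlt o hoU)⟩
    have := hJ.finrank_pspan_le hinf isClosed_closure hq3 ht (m := (γ + 1) * t - 1 + 1)
      (by rw [hH]; exact_mod_cast Nat.lt_succ_self _)
    rw [spanDim] at hq5
    rw [mul_add, mul_one]
    have : 0 < (γ + 1) * t := by positivity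
    omega
  · intro hform
    refine ⟨U, hU, hUd, fun q hq => ?_⟩
    obtain ⟨hinf, hqL, hH, hl⟩ := hfacts q hq
    obtain ⟨⟨-, hq3⟩, hq4, hq5, hq6⟩ := hUP q hq
    have hL := isIrreducible_linSet_pspan hinf.nonempty
    have hJ : JoinDense (entryLocus X q) t := by
      refine joinDense_of_pdim hinf hq3 ht ?_ hH
      rw [pdim_linSet_pspan hinf hq6, hq5]
      congr 2
      rw [mul_add, mul_one] at hform
      have : 0 < (γ + 1) * t := by positivity
      omega
    obtain ⟨F, ⟨p, hp, o, ho, hpo⟩, hF⟩ := hJ.exists_polynomial isClosed_closure hq3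
    obtain ⟨v, hvL, hv0, hvF⟩ : ∃ v ∈ pspan (entryLocus X q), v ≠ 0 ∧
        eval v (fixLeft F p) ≠ 0 := by
      by_contra! h
      rw [← eval_fixLeft] at hpo
      refine hpo (eval_eq_zero_of_mem_cone ⟨q, hqL⟩ (fun v hv hv0 => h v ?_ hv0) o ?_)
      · rwa [cone_linSet] at hv
      · rwa [cone_linSet]
    obtain ⟨W, hW, hvW, hWF⟩ := exists_isOpen_smul_eval_ne_zero hv0 hvF
    have hne := hL.2 U W hU hW ⟨q, hqL, hq⟩ ⟨_, (mk_mem_linSet hv0).2 hvL, hvW⟩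
    refine ⟨U ∩ W, hU.inter hW,
      subset_closure_inter_of_isPreirreducible_of_isOpen hL.2 (hU.inter hW) hne, ?_⟩
    rintro o ⟨hoL, hoU, hoW⟩
    obtain ⟨⟨⟨ho1, -⟩, ho3⟩, ho4, -⟩ := hUP o hoU
    refine (eq_of_subset_of_pdim_le isClosed_closure ho3 ?_ ho4 hq4.ge).symm
    have hlto := hlt o hoU
    induction o using Projectivization.ind with
    | h w hw =>
      obtain ⟨c, hc, hcw⟩ := hWF w hw hoW
      have hcw0 : c • w ≠ 0 := smul_ne_zero hc hw
      rw [← mk_smul hcw0 hw] at ho1 hlto hoL ⊢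
      exact subset_entryLocus_of_eval_ne_zero (entryLocus_subset hXc q) hinf hq3 ht hF hcw0
        ((mk_mem_linSet hcw0).1 hoL) ⟨p, hp, by rwa [← eval_fixLeft]⟩ ho1 hlto
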